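/- arXiv:1610.04357 — 2 statements merged into one kernel-verified Lean document; each statement's English description precedes it below -/
import Mathlib

section
/- Let c > 0 and let (G_n) be a sequence of finite connected simple graphs each with lazy Cheeger constant ch_L(G_n) > c, and let (s_n) be positive integers. For each n, let H_n be a graph obtained from G_n by choosing a subset of its edges and replacing each chosen edge by a path of length s_n (subdividing it with s_n − 1 new internal vertices of degree 2). Then there is a constant C (depending only on c) such that t_rel(H_n) ≤ C·s_n² for all n. -/
open Filter Finset

noncomputable section

variable {V : Type} [Fintype V] [DecidableEq V]

/-- `P` is a row-stochastic matrix. -/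
def IsStoch (P : Matrix V V ℝ) : Prop :=
  (∀ i j, 0 ≤ P i j) ∧ ∀ i, ∑ j, P i j = 1

/-- `π` is a probability vector with full support. -/
def IsProb (π : V → ℝ) : Prop := (∀ i, 0 < π i) ∧ ∑ i, π i = 1

/-- reversibility: `π x * P x y = π y * P y x`. -/
def Rev (P : Matrix V V ℝ) (π : V → ℝ) : Prop := ∀ i j, π i * P i j = π j * P j i

/-- irreducibility -/
def Irred (P : Matrix V V ℝ) : Prop := ∀ i j, ∃ t : ℕ, 0 < (P ^ t) i j

/-- the lazy version `(I + P)/2` of a chain -/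
def lazyM (P : Matrix V V ℝ) : Matrix V V ℝ := (2 : ℝ)⁻¹ • (1 + P)

/-- total variation distance -/
def tvDist (μ ν : V → ℝ) : ℝ := (∑ x, |μ x - ν x|) / 2

/-- worst-case total variation distance from stationarity at time `t` -/
def dTV (P : Matrix V V ℝ) (π : V → ℝ) (t : ℕ) : ℝ := ⨆ x, tvDist ((P ^ t) x) π

/-- the `ε` total-variation mixing time -/
def mixTime (P : Matrix V V ℝ) (π : V → ℝ) (ε : ℝ) : ℕ := sInf {t : ℕ | dTV P π t ≤ ε}

/-- worst-case separation distance at time `t` -/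
def dSep (P : Matrix V V ℝ) (π : V → ℝ) (t : ℕ) : ℝ := 1 - ⨅ x, ⨅ y, ((P ^ t) x y) / π y

/-- the `ε` separation time -/
def sepTime (P : Matrix V V ℝ) (π : V → ℝ) (ε : ℝ) : ℕ := sInf {t : ℕ | dSep P π t ≤ ε}

/-- the heat kernel `H_t = exp (t (P - I))` of the associated continuous-time chain -/
def heatKer (P : Matrix V V ℝ) (t : ℝ) : Matrix V V ℝ :=
  ∑' k : ℕ, (t ^ k / (Nat.factorial k : ℝ)) • ((P - 1) ^ k)

/-- separation distance of the continuous-time chain -/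
def dSepC (P : Matrix V V ℝ) (π : V → ℝ) (t : ℝ) : ℝ := 1 - ⨅ x, ⨅ y, (heatKer P t) x y / π y

/-- the `ε` separation time of the continuous-time chain -/
def sepTimeC (P : Matrix V V ℝ) (π : V → ℝ) (ε : ℝ) : ℝ := sInf {t : ℝ | 0 ≤ t ∧ dSepC P π t ≤ ε}

/-- degree of a vertex -/
def deg (G : SimpleGraph V) (v : V) : ℕ := Nat.card {u // G.Adj v u}

open Classical in
/-- transition matrix of the lazy simple random walk on `G` -/
def walkMat (G : SimpleGraph V) : Matrix V V ℝ :=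
  Matrix.of fun v u => if v = u then 1/2 else if G.Adj v u then 1 / (2 * (deg G v : ℝ)) else 0

/-- stationary distribution of the (lazy) simple random walk on `G` -/
def degSta (G : SimpleGraph V) (v : V) : ℝ := (deg G v : ℝ) / ∑ u, (deg G u : ℝ)

/-- the `ε` total-variation mixing time of the lazy simple random walk on `G` -/
def tmixG (G : SimpleGraph V) (ε : ℝ) : ℕ := mixTime (walkMat G) (degSta G) ε

/-- the second largest eigenvalue of a reversible transition matrix -/
def lam2 (P : Matrix V V ℝ) : ℝ :=
  sSup {μ : ℝ | μ ≠ 1 ∧ ∃ f : V → ℝ, f ≠ 0 ∧ P.mulVec f = μ • f}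

/-- the relaxation time `1/(1-λ₂)` -/
def trel (P : Matrix V V ℝ) : ℝ := 1 / (1 - lam2 P)

/-- the relaxation time of the lazy simple random walk on `G` -/
def trelG (G : SimpleGraph V) : ℝ := trel (walkMat G)

/-- transition matrix of the lazy random walk on the network with edge weights `w` -/
def wMat (w : V → V → ℝ) : Matrix V V ℝ :=
  Matrix.of fun v u => if v = u then 1/2 else w v u / (2 * ∑ x, w v x)

/-- stationary distribution of the lazy random walk on the network with edge weights `w` -/
def wSta (w : V → V → ℝ) (v : V) : ℝ := (∑ x, w v x) / ∑ u, ∑ x, w u x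

/-- `w` is a valid system of edge weights on the graph `G`: symmetric, positive on edges
and vanishing off the edges. -/
def GoodWeights (G : SimpleGraph V) (w : V → V → ℝ) : Prop :=
  (∀ u v, w u v = w v u) ∧ (∀ u v, G.Adj u v → 0 < w u v) ∧ ∀ u v, ¬ G.Adj u v → w u v = 0

/-- the `ε` total-variation mixing time of the lazy random walk on the weighted network -/
def tmixW (w : V → V → ℝ) (ε : ℝ) : ℕ := mixTime (wMat w) (wSta w) ε

/-- the probability of a discrete trajectory -/
def pathProb (P : Matrix V V ℝ) {k : ℕ} (w : Fin (k+1) → V) : ℝ :=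
  ∏ i : Fin k, P (w i.castSucc) (w i.succ)

/-- `P_x[T_y = k]`: probability that the chain started at `x` first hits `y` at time `k` -/
def firstHit (P : Matrix V V ℝ) (x y : V) (k : ℕ) : ℝ :=
  ∑ w : Fin (k+1) → V,
    if w 0 = x ∧ w (Fin.last k) = y ∧ ∀ i : Fin k, w i.castSucc ≠ y then pathProb P w else 0

/-- the restriction of `P - I` to the complement of `y` -/
def restrQ (P : Matrix V V ℝ) (y : V) : Matrix {w : V // w ≠ y} {w : V // w ≠ y} ℝ :=
  Matrix.of fun a b => P a.1 b.1 - if a = b then 1 else 0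

/-- `exp (t A)` where `A` is the restriction of `P - I` to the complement of `y` -/
def heatRestr (P : Matrix V V ℝ) (y : V) (t : ℝ) :
    Matrix {w : V // w ≠ y} {w : V // w ≠ y} ℝ :=
  ∑' k : ℕ, (t ^ k / (Nat.factorial k : ℝ)) • (restrQ P y ^ k)

/-- `P_x[T_B < r]` for the chain `P`: the probability that the set `B` is hit before time `r` -/
def hitByTime (P : Matrix V V ℝ) (B : Finset V) (x : V) (r : ℕ) : ℝ :=
  ∑ k ∈ Finset.range r, ∑ w : Fin (k+1) → V,
    if w 0 = x ∧ w (Fin.last k) ∈ B ∧ ∀ i : Fin k, w i.castSucc ∉ B then pathProb P w else 0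


open Classical in
/-- the lazy Cheeger constant of a graph:
`ch_L(G) = min {|∂_E S| / (2 Σ_{v ∈ S} deg v) : 0 < Σ_{v ∈ S} deg v ≤ |E|}`. -/
def lazyCheeger (G : SimpleGraph V) : ℝ :=
  sInf {r : ℝ | ∃ S : Finset V,
    (0 < ∑ v ∈ S, (deg G v : ℝ)) ∧
    ((∑ v ∈ S, (deg G v : ℝ)) ≤ (Nat.card G.edgeSet : ℝ)) ∧
    r = (∑ v ∈ S, ∑ u ∈ Sᶜ, if G.Adj v u then (1:ℝ) else 0) /
      (2 * ∑ v ∈ S, (deg G v : ℝ))}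

/-- the relation generating the graph obtained from `G` by replacing each (oriented) chosen
edge `(u,v) ∈ F` by a path of length `s` through `s - 1` new internal vertices. -/
def subdivRel {N : ℕ} (G : SimpleGraph (Fin N)) (F : Finset (Fin N × Fin N)) (s : ℕ) :
    (Fin N ⊕ ({p // p ∈ F} × Fin (s-1))) → (Fin N ⊕ ({p // p ∈ F} × Fin (s-1))) → Prop
  | Sum.inl u, Sum.inl v => G.Adj u v ∧ (((u, v) ∈ F ∨ (v, u) ∈ F) → s = 1)
  | Sum.inl u, Sum.inr ei =>
      (u = ei.1.1.1 ∧ (ei.2 : ℕ) = 0) ∨ (u = ei.1.1.2 ∧ (ei.2 : ℕ) = s - 2)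
  | Sum.inr ei, Sum.inr ej => ei.1 = ej.1 ∧ (ei.2 : ℕ) + 1 = (ej.2 : ℕ)
  | Sum.inr _, Sum.inl _ => False

/-- the graph obtained from `G` by stretching each chosen edge by a factor `s`. -/
def subdivide {N : ℕ} (G : SimpleGraph (Fin N)) (F : Finset (Fin N × Fin N)) (s : ℕ) :
    SimpleGraph (Fin N ⊕ ({p // p ∈ F} × Fin (s-1))) :=
  SimpleGraph.fromRel (subdivRel G F s)

section WeightedPoincare

/-- Discrete coarea inequality: an isoperimetric inequality for the subsets of a set supporting
`h` gives an `L¹` Poincaré inequality for `h`. -/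
lemma coarea_le (w : V → V → ℝ) {κ : ℝ} (T : Finset V)
    (hiso : ∀ S ⊆ T, κ * ∑ v ∈ S, ∑ u, w v u ≤ ∑ v ∈ S, ∑ u ∈ Sᶜ, w v u)
    (h : V → ℝ) (h0 : ∀ v, 0 ≤ h v) (hT : ∀ v, v ∉ T → h v = 0) :
    κ * ∑ v, (∑ u, w v u) * h v ≤ ∑ v, ∑ u, w v u * max (h v - h u) 0 := by
  induction hn : #{v | h v ≠ 0} using Nat.strong_induction_on generalizing h with
  | _ n ih =>
  set S : Finset V := {v | h v ≠ 0} with hS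
  have memS : ∀ v, v ∈ S ↔ h v ≠ 0 := by simp [hS]
  have notMemS : ∀ v, v ∉ S → h v = 0 := fun v hv => by
    by_contra hv'
    exact hv ((memS v).2 hv')
  rcases S.eq_empty_or_nonempty with hE | hne
  · have hz : ∀ v, h v = 0 := fun v => notMemS v (by simp [hE])
    simp [hz]
  obtain ⟨x, hxS, hx⟩ := S.exists_min_image h hne
  have hST : S ⊆ T := fun v hv => by
    by_contra hvT
    exact (memS v).1 hv (hT v hvT)
  set h' : V → ℝ := fun v => if v ∈ S then h v - h x else 0 with hh'
  have h'_nonneg : ∀ v, 0 ≤ h' v := fun v => by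
    by_cases hv : v ∈ S
    · simp [hh', hv, hx v hv]
    · simp [hh', hv]
  have hlt : #{v | h' v ≠ 0} < n := by
    rw [← hn]
    refine Finset.card_lt_card ⟨fun v hv => ?_, fun hsub => ?_⟩
    · by_contra hvS
      simp [hh', hvS] at hv
    · have := hsub hxS
      simp [hh'] at this
  have key := ih _ hlt h' h'_nonneg
    (fun v hv => if_neg fun hvS => hv (hST hvS)) rfl
  have hvol : ∑ v, (∑ u, w v u) * h v
      = ∑ v, (∑ u, w v u) * h' v + h x * ∑ v ∈ S, ∑ u, w v u := by
    rw [← Finset.sum_ite_mem_eq S, Finset.mul_sum, ← Finset.sum_add_distrib]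
    refine Finset.sum_congr rfl fun v _ => ?_
    by_cases hv : v ∈ S
    · simp [hh', hv]; ring
    · simp [hh', hv, notMemS v hv]
  have hbdry : ∑ v, ∑ u, w v u * max (h v - h u) 0
      = ∑ v, ∑ u, w v u * max (h' v - h' u) 0 + h x * ∑ v ∈ S, ∑ u ∈ Sᶜ, w v u := by
    rw [← Finset.sum_ite_mem_eq S, Finset.mul_sum, ← Finset.sum_add_distrib]
    refine Finset.sum_congr rfl fun v _ => ?_
    by_cases hv : v ∈ S
    · rw [if_pos hv, ← Finset.sum_ite_mem_eq Sᶜ, Finset.mul_sum, ← Finset.sum_add_distrib]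
      refine Finset.sum_congr rfl fun u _ => ?_
      by_cases hu : u ∈ S
      · simp [hh', hv, hu]
      · have h1 := hx v hv
        have h2 := h0 v
        simp [hh', hv, hu, notMemS u hu, h1, h2]; ring
    · rw [if_neg hv, mul_zero, add_zero]
      refine Finset.sum_congr rfl fun u _ => ?_
      have h1 : h' v = 0 := by simp [hh', hv]
      simp [notMemS v hv, h1, h0 u, h'_nonneg u]
  rw [hvol, hbdry]
  nlinarith [mul_le_mul_of_nonneg_left (hiso S hST) (h0 x)]

/-- Cheeger's inequality for a function supported on a set whose subsets satisfy an
isoperimetric inequality. -/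
lemma dirichlet_poincare (w : V → V → ℝ) (hw : ∀ u v, w u v = w v u) (hw0 : ∀ u v, 0 ≤ w u v)
    {κ : ℝ} (hκ : 0 < κ) (T : Finset V)
    (hiso : ∀ S ⊆ T, κ * ∑ v ∈ S, ∑ u, w v u ≤ ∑ v ∈ S, ∑ u ∈ Sᶜ, w v u)
    (g : V → ℝ) (hT : ∀ v, v ∉ T → g v = 0) :
    κ ^ 2 * ∑ v, ∑ u, w v u * g v ^ 2 ≤ ∑ v, ∑ u, w v u * (g v - g u) ^ 2 := by
  have hco := coarea_le w T hiso (fun v => g v ^ 2) (fun v => sq_nonneg _)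
    (fun v hv => by simp [hT v hv])
  set M := ∑ v, ∑ u, w v u * max (g v ^ 2 - g u ^ 2) 0 with hM
  set Q := ∑ v, ∑ u, w v u * g v ^ 2 with hQ
  set D := ∑ v, ∑ u, w v u * (g v - g u) ^ 2 with hD
  have hQ' : ∑ v, (∑ u, w v u) * g v ^ 2 = Q := by simp [hQ, Finset.sum_mul]
  have swap : ∀ φ : V → V → ℝ, ∑ v, ∑ u, w v u * φ v u = ∑ v, ∑ u, w v u * φ u v := fun φ => by
    rw [Finset.sum_comm]
    simp [hw]
  have hQs : ∑ v, ∑ u, w v u * g u ^ 2 = Q := (swap fun v _ => g v ^ 2).symm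
  have hMs : ∑ v, ∑ u, w v u * max (g u ^ 2 - g v ^ 2) 0 = M :=
    (swap fun v u => max (g v ^ 2 - g u ^ 2) 0).symm
  have hpt : ∀ v u, κ * max (g v ^ 2 - g u ^ 2) 0 + κ * max (g u ^ 2 - g v ^ 2) 0
      ≤ (g v - g u) ^ 2 + κ ^ 2 / 2 * g v ^ 2 + κ ^ 2 / 2 * g u ^ 2 := fun v u => by
    rcases le_total (g v ^ 2) (g u ^ 2) with h | h
    · rw [max_eq_right (by linarith), max_eq_left (by linarith)]
      nlinarith [sq_nonneg ((g u - g v) - κ / 2 * (g u + g v)), sq_nonneg (κ * (g u - g v))]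
    · rw [max_eq_left (by linarith), max_eq_right (by linarith)]
      nlinarith [sq_nonneg ((g v - g u) - κ / 2 * (g u + g v)), sq_nonneg (κ * (g u - g v))]
  have hsum : κ * M + κ * M ≤ D + κ ^ 2 / 2 * Q + κ ^ 2 / 2 * Q := by
    calc κ * M + κ * M
        = κ * M + κ * ∑ v, ∑ u, w v u * max (g u ^ 2 - g v ^ 2) 0 := by rw [hMs]
      _ ≤ D + κ ^ 2 / 2 * Q + κ ^ 2 / 2 * ∑ v, ∑ u, w v u * g u ^ 2 := by
        simp only [hM, hD, hQ, Finset.mul_sum, ← Finset.sum_add_distrib]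
        refine Finset.sum_le_sum fun v _ => Finset.sum_le_sum fun u _ => ?_
        nlinarith [mul_le_mul_of_nonneg_left (hpt v u) (hw0 v u)]
      _ = _ := by rw [hQs]
  rw [hQ'] at hco
  nlinarith [mul_le_mul_of_nonneg_left hco hκ.le]

/-- Existence of a median with respect to a finite measure. -/
lemma exists_median [Nonempty V] (d : V → ℝ) (hd : ∀ v, 0 ≤ d v) (f : V → ℝ) :
    ∃ a, 2 * ∑ v with a < f v, d v ≤ ∑ v, d v ∧ 2 * ∑ v with f v < a, d v ≤ ∑ v, d v := by
  have htot : 0 ≤ ∑ v, d v := Finset.sum_nonneg fun v _ => hd v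
  let T : Finset V := {x | 2 * ∑ v with f x < f v, d v ≤ ∑ v, d v}
  obtain ⟨m, -, hm⟩ := Finset.univ.exists_max_image f Finset.univ_nonempty
  have hne : T.Nonempty := ⟨m, by
    have : (Finset.univ.filter fun v => f m < f v) = ∅ := by
      ext v
      simpa using hm v (Finset.mem_univ v)
    simp [T, this, htot]⟩
  obtain ⟨x, hxT, hx⟩ := T.exists_min_image f hne
  refine ⟨f x, by simpa [T] using hxT, ?_⟩
  rcases (Finset.univ.filter fun v => f v < f x).eq_empty_or_nonempty with hE | hL
  · simp [hE, htot]
  obtain ⟨y, hyL, hy⟩ := Finset.exists_max_image _ f hL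
  have hyT : y ∉ T := fun h => by
    have := hx y h
    simp only [Finset.mem_filter] at hyL
    linarith [hyL.2]
  have hylt : ∑ v, d v < 2 * ∑ v with f y < f v, d v := by simpa [T] using hyT
  have hdisj : ∑ v with f v < f x, d v + ∑ v with f y < f v, d v ≤ ∑ v, d v := by
    rw [← Finset.sum_union]
    · exact Finset.sum_le_sum_of_subset_of_nonneg (Finset.subset_univ _) fun v _ _ => hd v
    · rw [Finset.disjoint_left]
      intro v hv hv'
      have := hy v hv
      simp only [Finset.mem_filter] at hv'
      linarith [hv'.2]
  linarith

/-- Cheeger's inequality for weighted graphs, in the form of a Poincaré inequality. -/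
lemma exists_poincare_of_isoperimetric [Nonempty V] (w : V → V → ℝ) (hw : ∀ u v, w u v = w v u)
    (hw0 : ∀ u v, 0 ≤ w u v) {κ : ℝ} (hκ : 0 < κ)
    (hiso : ∀ S : Finset V, 2 * ∑ v ∈ S, ∑ u, w v u ≤ ∑ v, ∑ u, w v u →
      κ * ∑ v ∈ S, ∑ u, w v u ≤ ∑ v ∈ S, ∑ u ∈ Sᶜ, w v u) (f : V → ℝ) :
    ∃ a, κ ^ 2 * ∑ v, ∑ u, w v u * (f v - a) ^ 2 ≤ ∑ v, ∑ u, w v u * (f v - f u) ^ 2 := by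
  have hd : ∀ v, 0 ≤ ∑ u, w v u := fun v => Finset.sum_nonneg fun u _ => hw0 v u
  obtain ⟨a, ha, ha'⟩ := exists_median (fun v => ∑ u, w v u) hd f
  have sub : ∀ T : Finset V, 2 * ∑ v ∈ T, ∑ u, w v u ≤ ∑ v, ∑ u, w v u → ∀ S ⊆ T,
      κ * ∑ v ∈ S, ∑ u, w v u ≤ ∑ v ∈ S, ∑ u ∈ Sᶜ, w v u := fun T hT S hST => by
    refine hiso S (le_trans ?_ hT)
    have := Finset.sum_le_sum_of_subset_of_nonneg hST fun v _ _ => hd v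
    linarith
  have hp := dirichlet_poincare w hw hw0 hκ _ (sub _ ha) (fun v => max (f v - a) 0)
    (fun v hv => by simpa using hv)
  have hm := dirichlet_poincare w hw hw0 hκ _ (sub _ ha') (fun v => max (a - f v) 0)
    (fun v hv => by simpa using hv)
  refine ⟨a, ?_⟩
  have hsq : ∀ v, (f v - a) ^ 2 = max (f v - a) 0 ^ 2 + max (a - f v) 0 ^ 2 := fun v => by
    rcases le_total (f v) a with h | h
    · rw [max_eq_right (by linarith), max_eq_left (by linarith)]; ring
    · rw [max_eq_left (by linarith), max_eq_right (by linarith)]; ring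
  have hgrad : ∀ v u, (max (f v - a) 0 - max (f u - a) 0) ^ 2
      + (max (a - f v) 0 - max (a - f u) 0) ^ 2 ≤ (f v - f u) ^ 2 := fun v u => by
    have h1 : ∀ v, f v - a = max (f v - a) 0 - max (a - f v) 0 := fun v => by
      rcases le_total (f v) a with h | h
      · rw [max_eq_right (by linarith), max_eq_left (by linarith)]; ring
      · rw [max_eq_left (by linarith), max_eq_right (by linarith)]; ring
    have h2 : ∀ v, max (f v - a) 0 * max (a - f v) 0 = 0 := fun v => by
      rcases le_total (f v) a with h | h
      · rw [max_eq_right (by linarith)]; ring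
      · rw [max_eq_right (b := (0 : ℝ)) (a := a - f v) (by linarith)]; ring
    have h3 : (f v - f u) ^ 2 = (max (f v - a) 0 - max (a - f v) 0
        - (max (f u - a) 0 - max (a - f u) 0)) ^ 2 := by rw [← h1 v, ← h1 u]; ring
    nlinarith [h2 v, h2 u, h3,
      mul_nonneg (le_max_right (f v - a) 0) (le_max_right (a - f u) 0),
      mul_nonneg (le_max_right (f u - a) 0) (le_max_right (a - f v) 0)]
  calc κ ^ 2 * ∑ v, ∑ u, w v u * (f v - a) ^ 2
      = κ ^ 2 * ∑ v, ∑ u, w v u * max (f v - a) 0 ^ 2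
        + κ ^ 2 * ∑ v, ∑ u, w v u * max (a - f v) 0 ^ 2 := by
        simp only [hsq, mul_add, Finset.sum_add_distrib]
    _ ≤ _ := add_le_add hp hm
    _ ≤ _ := by
        simp only [← Finset.sum_add_distrib, ← mul_add]
        exact Finset.sum_le_sum fun v _ => Finset.sum_le_sum fun u _ =>
          mul_le_mul_of_nonneg_left (hgrad v u) (hw0 v u)

end WeightedPoincare

section Walk

open Classical in
/-- The `0`-`1` edge weights of a graph. -/
def adjWeight {W : Type*} (G : SimpleGraph W) (v u : W) : ℝ := if G.Adj v u then 1 else 0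

open Classical in
/-- The ordered pairs of adjacent vertices of a graph. -/
def adjPairs {W : Type*} [Fintype W] (G : SimpleGraph W) : Finset (W × W) := {p | G.Adj p.1 p.2}

lemma mem_adjPairs {W : Type*} [Fintype W] {G : SimpleGraph W} {p : W × W} :
    p ∈ adjPairs G ↔ G.Adj p.1 p.2 := by
  simp [adjPairs]

lemma sum_adjWeight_mul {W : Type*} [Fintype W] (G : SimpleGraph W) (φ : W → W → ℝ) :
    ∑ v, ∑ u, adjWeight G v u * φ v u = ∑ p ∈ adjPairs G, φ p.1 p.2 := by
  rw [← Fintype.sum_prod_type', adjPairs, Finset.sum_filter]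
  exact Finset.sum_congr rfl fun p _ => by simp [adjWeight]

lemma adjWeight_comm {W : Type*} (G : SimpleGraph W) (v u : W) :
    adjWeight G v u = adjWeight G u v := by
  by_cases h : G.Adj v u <;> simp [adjWeight, h, G.adj_comm u v]

lemma adjWeight_nonneg {W : Type*} (G : SimpleGraph W) (v u : W) : 0 ≤ adjWeight G v u := by
  unfold adjWeight; split_ifs <;> norm_num

lemma deg_eq_degree {W : Type} [Fintype W] (G : SimpleGraph W) [DecidableRel G.Adj] (v : W) :
    deg G v = G.degree v := by
  rw [deg, ← SimpleGraph.card_neighborSet_eq_degree, ← Nat.card_eq_fintype_card]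
  rfl

lemma deg_eq_sum_adjWeight {W : Type} [Fintype W] (G : SimpleGraph W) (v : W) :
    (deg G v : ℝ) = ∑ u, adjWeight G v u := by
  classical
  rw [deg_eq_degree, ← SimpleGraph.card_neighborFinset_eq_degree,
    SimpleGraph.neighborFinset_eq_filter]
  simp [adjWeight]

lemma sum_adjWeight_eq_two_mul_card_edgeSet {W : Type} [Fintype W] (G : SimpleGraph W) :
    ∑ v, ∑ u, adjWeight G v u = 2 * (Nat.card G.edgeSet : ℝ) := by
  classical
  simp only [← deg_eq_sum_adjWeight, deg_eq_degree]
  rw [Nat.card_eq_fintype_card, ← SimpleGraph.edgeFinset_card]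
  exact_mod_cast G.sum_degrees_eq_twice_card_edges

lemma isoperimetric_of_le_lazyCheeger (G : SimpleGraph V) {c : ℝ} (hc : c ≤ lazyCheeger G)
    (S : Finset V) (hS : 2 * ∑ v ∈ S, ∑ u, adjWeight G v u ≤ ∑ v, ∑ u, adjWeight G v u) :
    2 * c * ∑ v ∈ S, ∑ u, adjWeight G v u ≤ ∑ v ∈ S, ∑ u ∈ Sᶜ, adjWeight G v u := by
  have hb : 0 ≤ ∑ v ∈ S, ∑ u ∈ Sᶜ, adjWeight G v u :=
    Finset.sum_nonneg fun v _ => Finset.sum_nonneg fun u _ => adjWeight_nonneg G v u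
  have hvol : 0 ≤ ∑ v ∈ S, ∑ u, adjWeight G v u :=
    Finset.sum_nonneg fun v _ => Finset.sum_nonneg fun u _ => adjWeight_nonneg G v u
  rcases hvol.eq_or_lt with h0 | hpos
  · rw [← h0]; simpa using hb
  have hle : c ≤ (∑ v ∈ S, ∑ u ∈ Sᶜ, adjWeight G v u) /
      (2 * ∑ v ∈ S, ∑ u, adjWeight G v u) := by
    refine hc.trans (csInf_le ⟨0, ?_⟩ ⟨S, ?_, ?_, ?_⟩)
    · rintro r ⟨T, hT, -, rfl⟩
      exact div_nonneg (Finset.sum_nonneg fun v _ => Finset.sum_nonneg fun u _ =>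
        adjWeight_nonneg G v u) (by linarith)
    · simpa only [deg_eq_sum_adjWeight] using hpos
    · rw [sum_adjWeight_eq_two_mul_card_edgeSet] at hS
      simp only [deg_eq_sum_adjWeight]
      linarith
    · simp only [deg_eq_sum_adjWeight]
      rfl
  rw [le_div_iff₀ (by linarith)] at hle
  linarith

lemma deg_mul_walkMat_mulVec (G : SimpleGraph V) (f : V → ℝ) (v : V) :
    (∑ u, adjWeight G v u) * (walkMat G).mulVec f v
      = ((∑ u, adjWeight G v u) * f v + ∑ u, adjWeight G v u * f u) / 2 := by
  have hP : (walkMat G).mulVec f v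
      = f v / 2 + (∑ u, adjWeight G v u * f u) / (2 * ∑ u, adjWeight G v u) := by
    rw [← deg_eq_sum_adjWeight, Finset.sum_div, Matrix.mulVec, dotProduct]
    have : f v / 2 = ∑ u, if v = u then f u / 2 else 0 := by simp
    rw [this, ← Finset.sum_add_distrib]
    refine Finset.sum_congr rfl fun u _ => ?_
    by_cases huv : v = u
    · subst huv
      simp [walkMat, adjWeight]; ring
    · by_cases hadj : G.Adj v u
      · simp [walkMat, adjWeight, huv, hadj]; ring
      · simp [walkMat, adjWeight, huv, hadj]
  rw [hP]
  rcases eq_or_ne (∑ u, adjWeight G v u) 0 with h0 | h0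
  · have hz := (Finset.sum_eq_zero_iff_of_nonneg fun u _ => adjWeight_nonneg G v u).1 h0
    rw [h0, Finset.sum_eq_zero fun u hu => by rw [hz u hu, zero_mul]]
    simp
  · field_simp

/-- A Poincaré inequality bounds the relaxation time of the lazy simple random walk. -/
lemma trelG_le_of_poincare (G : SimpleGraph V) {K : ℝ} (hK : 1 ≤ K)
    (hP : ∀ f : V → ℝ, ∃ a, ∑ v, ∑ u, adjWeight G v u * (f v - a) ^ 2
      ≤ K * ∑ v, ∑ u, adjWeight G v u * (f v - f u) ^ 2) :
    trelG G ≤ 4 * K := by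
  have hinv : 1 / (4 * K) ≤ 1 / 4 := one_div_le_one_div_of_le (by norm_num) (by linarith)
  have hlam : lam2 (walkMat G) ≤ 1 - 1 / (4 * K) := by
    refine Real.sSup_le ?_ (by linarith)
    rintro μ ⟨hμ, f, hf, hPf⟩
    set d : V → ℝ := fun v => ∑ u, adjWeight G v u with hd
    have hev : ∀ v, d v * (μ * f v) = (d v * f v + ∑ u, adjWeight G v u * f u) / 2 := fun v => by
      rw [← deg_mul_walkMat_mulVec, hPf]; rfl
    have swap : ∀ φ : V → ℝ, ∑ v, ∑ u, adjWeight G v u * φ u = ∑ v, d v * φ v := fun φ => by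
      rw [Finset.sum_comm]
      simp only [hd, Finset.sum_mul]
      exact Finset.sum_congr rfl fun v _ => Finset.sum_congr rfl fun u _ => by
        rw [adjWeight_comm]
    have hmean : ∑ v, d v * f v = 0 := by
      have h1 : ∑ v, d v * (μ * f v) = ∑ v, d v * f v := by
        simp only [hev, ← Finset.sum_div, Finset.sum_add_distrib, swap]
        ring
      have h2 : ∑ v, d v * (μ * f v) = μ * ∑ v, d v * f v := by
        rw [Finset.mul_sum]; exact Finset.sum_congr rfl fun v _ => by ring
      have h3 : (μ - 1) * ∑ v, d v * f v = 0 := by linarith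
      exact (mul_eq_zero.1 h3).resolve_left (sub_ne_zero.2 hμ)
    have hdir : ∑ v, ∑ u, adjWeight G v u * (f v - f u) ^ 2
        = 4 * (1 - μ) * ∑ v, d v * f v ^ 2 := by
      have h1 : ∑ v, ∑ u, adjWeight G v u * (f v - f u) ^ 2
          = ∑ v, d v * f v ^ 2 + ∑ v, ∑ u, adjWeight G v u * f u ^ 2
            - 2 * ∑ v, f v * ∑ u, adjWeight G v u * f u := by
        simp only [hd, Finset.mul_sum, Finset.sum_mul, ← Finset.sum_add_distrib,
          ← Finset.sum_sub_distrib]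
        exact Finset.sum_congr rfl fun v _ => Finset.sum_congr rfl fun u _ => by ring
      have h2 : ∑ v, f v * ∑ u, adjWeight G v u * f u = (2 * μ - 1) * ∑ v, d v * f v ^ 2 := by
        rw [Finset.mul_sum]
        exact Finset.sum_congr rfl fun v _ => by linear_combination (-2 * f v) * hev v
      rw [h1, h2, swap fun u => f u ^ 2]
      ring
    have hd0 : ∀ v, 0 ≤ d v := fun v => Finset.sum_nonneg fun u _ => adjWeight_nonneg G v u
    have hnn : ∀ v, 0 ≤ d v * f v ^ 2 := fun v => mul_nonneg (hd0 v) (sq_nonneg _)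
    rcases (Finset.sum_nonneg fun v (_ : v ∈ Finset.univ) => hnn v).eq_or_lt with h0 | hpos
    · obtain ⟨v, hv⟩ := Function.ne_iff.1 hf
      have hv' : f v ≠ 0 := hv
      have hdv : d v = 0 := by
        have := (Finset.sum_eq_zero_iff_of_nonneg fun v _ => hnn v).1 h0.symm v (Finset.mem_univ v)
        exact (mul_eq_zero.1 this).resolve_right (pow_ne_zero 2 hv')
      have hw : ∀ u, adjWeight G v u = 0 := fun u =>
        (Finset.sum_eq_zero_iff_of_nonneg fun u _ => adjWeight_nonneg G v u).1 hdv u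
          (Finset.mem_univ u)
      have hna : ∀ u, ¬ G.Adj v u := fun u hu => by simpa [adjWeight, hu] using hw u
      have : f v / 2 = μ * f v := by
        have := congrFun hPf v
        simp only [Matrix.mulVec, dotProduct, walkMat, hna, Matrix.of_apply, if_false, ite_mul,
          zero_mul, Finset.sum_ite_eq, Finset.mem_univ, if_true, Pi.smul_apply, smul_eq_mul] at this
        linarith
      have hμ2 : μ = 1 / 2 := mul_right_cancel₀ hv' (by linarith)
      linarith
    · obtain ⟨a, ha⟩ := hP f
      have hvar : ∑ v, d v * f v ^ 2 ≤ ∑ v, ∑ u, adjWeight G v u * (f v - a) ^ 2 := by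
        have : ∑ v, ∑ u, adjWeight G v u * (f v - a) ^ 2
            = ∑ v, d v * f v ^ 2 - 2 * a * ∑ v, d v * f v + ∑ v, d v * a ^ 2 := by
          simp only [hd, Finset.mul_sum, Finset.sum_mul, ← Finset.sum_add_distrib,
            ← Finset.sum_sub_distrib]
          exact Finset.sum_congr rfl fun v _ => Finset.sum_congr rfl fun u _ => by ring
        rw [this, hmean]
        have := Finset.sum_nonneg fun v (_ : v ∈ Finset.univ) =>
          mul_nonneg (hd0 v) (sq_nonneg a)
        linarith
      rw [hdir] at ha
      have h1 : 1 ≤ (1 - μ) * (4 * K) :=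
        le_of_mul_le_mul_right (by linarith) hpos
      have := (div_le_iff₀ (show (0 : ℝ) < 4 * K by linarith)).2 h1
      linarith
  rw [trelG, trel]
  have hpos : 0 < 1 / (4 * K) := by positivity
  calc 1 / (1 - lam2 (walkMat G)) ≤ 1 / (1 / (4 * K)) :=
        one_div_le_one_div_of_le hpos (by linarith)
    _ = 4 * K := one_div_one_div _

end Walk

section Subdivision

lemma sum_le_sum_of_cover {α β : Type*} (S : Finset β) (I : Finset α) (m : α → β) (φ : β → ℝ)
    (hφ : ∀ b, 0 ≤ φ b) (hcover : ∀ b ∈ S, ∃ a ∈ I, m a = b) :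
    ∑ b ∈ S, φ b ≤ ∑ a ∈ I, φ (m a) := by
  classical
  calc ∑ b ∈ S, φ b ≤ ∑ b ∈ S, ∑ a ∈ I with m a = b, φ (m a) := by
        refine Finset.sum_le_sum fun b hb => ?_
        obtain ⟨a, ha, rfl⟩ := hcover b hb
        exact Finset.single_le_sum (f := fun a => φ (m a)) (fun _ _ => hφ _)
          (Finset.mem_filter.2 ⟨ha, rfl⟩)
    _ ≤ ∑ a ∈ I, φ (m a) := Finset.sum_fiberwise_le_sum_of_sum_fiber_nonneg fun b _ =>
        Finset.sum_nonneg fun _ _ => hφ _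

lemma sum_le_sum_of_injOn_mapsTo {α β : Type*} (I : Finset α) (S : Finset β) (m : α → β)
    (φ : β → ℝ) (hφ : ∀ b, 0 ≤ φ b) (hm : ∀ a ∈ I, m a ∈ S) (hinj : Set.InjOn m I) :
    ∑ a ∈ I, φ (m a) ≤ ∑ b ∈ S, φ b := by
  classical
  rw [← Finset.sum_image hinj]
  exact Finset.sum_le_sum_of_subset_of_nonneg (Finset.image_subset_iff.2 hm) fun b _ _ => hφ b

lemma sq_sub_le_mul_sum_sq (x : ℕ → ℝ) {k s : ℕ} (hk : k ≤ s) :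
    (x k - x 0) ^ 2 ≤ s * ∑ j ∈ Finset.range s, (x j - x (j + 1)) ^ 2 := by
  have h0 : 0 ≤ ∑ j ∈ Finset.range k, (x j - x (j + 1)) ^ 2 :=
    Finset.sum_nonneg fun _ _ => sq_nonneg _
  have h1 : ∑ j ∈ Finset.range k, (x j - x (j + 1)) ^ 2
      ≤ ∑ j ∈ Finset.range s, (x j - x (j + 1)) ^ 2 :=
    Finset.sum_le_sum_of_subset_of_nonneg (Finset.range_subset_range.2 hk)
      fun _ _ _ => sq_nonneg _
  calc (x k - x 0) ^ 2 = (∑ j ∈ Finset.range k, (x j - x (j + 1))) ^ 2 := by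
        rw [Finset.sum_range_sub']; ring
    _ ≤ k * ∑ j ∈ Finset.range k, (x j - x (j + 1)) ^ 2 := by
        simpa using sq_sum_le_card_mul_sum_sq (s := Finset.range k)
          (f := fun j => x j - x (j + 1))
    _ ≤ _ := by gcongr

variable {N : ℕ}

/-- The `k`-th vertex of the path replacing the edge `e`. -/
def subdivPath (F : Finset (Fin N × Fin N)) (s : ℕ) (e : {p // p ∈ F}) (k : ℕ) :
    Fin N ⊕ ({p // p ∈ F} × Fin (s - 1)) :=
  if k = 0 then Sum.inl e.1.1
  else if h : k - 1 < s - 1 then Sum.inr (e, ⟨k - 1, h⟩) else Sum.inl e.1.2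

/-- The ordered pairs of adjacent vertices of `G` whose edge is not replaced. -/
def unsplitPairs (G : SimpleGraph (Fin N)) (F : Finset (Fin N × Fin N)) :
    Finset (Fin N × Fin N) :=
  {p ∈ adjPairs G | p ∉ F ∧ p.swap ∉ F}

variable {G : SimpleGraph (Fin N)} {F : Finset (Fin N × Fin N)} {s : ℕ}

lemma subdivPath_zero (e : {p // p ∈ F}) : subdivPath F s e 0 = Sum.inl e.1.1 := rfl

lemma subdivPath_last (hs : 1 ≤ s) (e : {p // p ∈ F}) :
    subdivPath F s e s = Sum.inl e.1.2 := by
  rw [subdivPath, if_neg (by omega), dif_neg (by omega)]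

lemma subdivPath_succ (e : {p // p ∈ F}) (i : Fin (s - 1)) :
    subdivPath F s e (i + 1) = Sum.inr (e, i) := by
  simp [subdivPath]

lemma subdivPath_cases (e : {p // p ∈ F}) {k : ℕ} (hk : k < s) :
    (k = 0 ∧ subdivPath F s e k = Sum.inl e.1.1) ∨
      ∃ i : Fin (s - 1), k = i + 1 ∧ subdivPath F s e k = Sum.inr (e, i) := by
  rcases k with _ | k
  · exact Or.inl ⟨rfl, rfl⟩
  · exact Or.inr ⟨⟨k, by omega⟩, rfl, subdivPath_succ e ⟨k, by omega⟩⟩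

lemma subdivPath_succ_cases (e : {p // p ∈ F}) {k : ℕ} (hk : k < s) :
    (k + 1 = s ∧ subdivPath F s e (k + 1) = Sum.inl e.1.2) ∨
      ∃ i : Fin (s - 1), k = i ∧ subdivPath F s e (k + 1) = Sum.inr (e, i) := by
  rcases Nat.lt_or_ge (k + 1) s with h | h
  · exact Or.inr ⟨⟨k, by omega⟩, rfl, subdivPath_succ e ⟨k, by omega⟩⟩
  · have : k + 1 = s := by omega
    exact Or.inl ⟨this, by rw [this, subdivPath_last (by omega)]⟩

lemma subdivide_adj_subdivPath (hF : ∀ p ∈ F, G.Adj p.1 p.2) (e : {p // p ∈ F}) {k : ℕ}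
    (hk : k < s) :
    (subdivide G F s).Adj (subdivPath F s e k) (subdivPath F s e (k + 1)) := by
  rw [subdivide, SimpleGraph.fromRel_adj]
  have he := hF e.1 e.2
  rcases subdivPath_cases e hk with ⟨hk0, h1⟩ | ⟨i, hi, h1⟩ <;>
    rcases subdivPath_succ_cases e hk with ⟨hks, h2⟩ | ⟨j, hj, h2⟩ <;> rw [h1, h2]
  · refine ⟨fun h => he.ne (Sum.inl.inj h), Or.inl ⟨he, fun _ => by omega⟩⟩
  · exact ⟨by simp, Or.inl (Or.inl ⟨rfl, by simp only; omega⟩)⟩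
  · exact ⟨by simp, Or.inr (Or.inr ⟨rfl, by simp only; omega⟩)⟩
  · refine ⟨fun h => ?_, Or.inl ⟨rfl, by simp only; omega⟩⟩
    have := congrArg Fin.val (Prod.mk.inj (Sum.inr.inj h)).2
    omega

lemma exists_of_subdivRel {x y : Fin N ⊕ ({p // p ∈ F} × Fin (s - 1))}
    (hs : 1 ≤ s) (h : subdivRel G F s x y) :
    (∃ p ∈ unsplitPairs G F, x = Sum.inl p.1 ∧ y = Sum.inl p.2) ∨
      ∃ e : {p // p ∈ F}, ∃ k : Fin s,
        (x = subdivPath F s e k ∧ y = subdivPath F s e (k + 1)) ∨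
        (x = subdivPath F s e (k + 1) ∧ y = subdivPath F s e k) := by
  rcases x with u | ⟨e, i⟩ <;> rcases y with v | ⟨e', j⟩
  · obtain ⟨hadj, hsplit⟩ := h
    by_cases h1 : (u, v) ∈ F
    · obtain rfl := hsplit (Or.inl h1)
      exact Or.inr ⟨⟨_, h1⟩, 0, Or.inl ⟨rfl, rfl⟩⟩
    by_cases h2 : (v, u) ∈ F
    · obtain rfl := hsplit (Or.inr h2)
      exact Or.inr ⟨⟨_, h2⟩, 0, Or.inr ⟨rfl, rfl⟩⟩
    · exact Or.inl ⟨(u, v), by simp [unsplitPairs, mem_adjPairs, hadj, h1, h2], rfl, rfl⟩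
  · right
    have hj := j.2
    rcases h with ⟨rfl, hj0⟩ | ⟨rfl, hj0⟩
    · refine ⟨e', ⟨0, hs⟩, Or.inl ⟨rfl, ?_⟩⟩
      rw [← subdivPath_succ]
      exact congrArg (fun k => subdivPath F s e' (k + 1)) hj0
    · refine ⟨e', ⟨j + 1, by omega⟩, Or.inr ⟨?_, (subdivPath_succ e' j).symm⟩⟩
      have : (j : ℕ) + 1 + 1 = s := by simp only at hj0; omega
      simp only [this, subdivPath_last hs]
  · exact h.elim
  · obtain ⟨h1, hij⟩ := h
    simp only at h1 hij
    subst h1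
    refine Or.inr ⟨e, ⟨j, by omega⟩, Or.inl ⟨?_, (subdivPath_succ e j).symm⟩⟩
    rw [← subdivPath_succ]
    exact congrArg _ hij

lemma exists_of_subdivide_adj {x y : Fin N ⊕ ({p // p ∈ F} × Fin (s - 1))}
    (hs : 1 ≤ s) (h : (subdivide G F s).Adj x y) :
    (∃ p ∈ unsplitPairs G F, x = Sum.inl p.1 ∧ y = Sum.inl p.2) ∨
      ∃ e : {p // p ∈ F}, ∃ k : Fin s,
        (x = subdivPath F s e k ∧ y = subdivPath F s e (k + 1)) ∨
        (x = subdivPath F s e (k + 1) ∧ y = subdivPath F s e k) := by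
  rw [subdivide, SimpleGraph.fromRel_adj] at h
  rcases h.2 with h | h
  · exact exists_of_subdivRel hs h
  · rcases exists_of_subdivRel hs h with ⟨p, hp, hx, hy⟩ | ⟨e, k, h | h⟩
    · refine Or.inl ⟨p.swap, ?_, hy, hx⟩
      simp only [unsplitPairs, Finset.mem_filter, mem_adjPairs, Prod.swap_swap, Prod.fst_swap,
        Prod.snd_swap] at hp ⊢
      exact ⟨hp.1.symm, hp.2.2, hp.2.1⟩
    · exact Or.inr ⟨e, k, Or.inr ⟨h.2, h.1⟩⟩
    · exact Or.inr ⟨e, k, Or.inl ⟨h.2, h.1⟩⟩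

/-- The degree-weighted sum of a nonnegative function over a subdivided graph is bounded by sums
over the original graph and over the inserted paths. -/
lemma sum_subdivide_le (hs : 1 ≤ s) (g : Fin N ⊕ ({p // p ∈ F} × Fin (s - 1)) → ℝ)
    (hg : ∀ x, 0 ≤ g x) :
    ∑ p ∈ adjPairs (subdivide G F s), g p.1 ≤ ∑ p ∈ adjPairs G, g (Sum.inl p.1)
      + ∑ e : {p // p ∈ F}, ∑ k ∈ Finset.range s,
        (g (subdivPath F s e k) + g (subdivPath F s e (k + 1))) := by
  have hcover := sum_le_sum_of_cover (adjPairs (subdivide G F s))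
    ((unsplitPairs G F).disjSum
      ((Finset.univ : Finset ({p // p ∈ F} × Fin s)).disjSum
        (Finset.univ : Finset ({p // p ∈ F} × Fin s))))
    (Sum.elim (fun p => (Sum.inl p.1, Sum.inl p.2)) (Sum.elim
      (fun q => (subdivPath F s q.1 q.2, subdivPath F s q.1 (q.2 + 1)))
      (fun q => (subdivPath F s q.1 (q.2 + 1), subdivPath F s q.1 q.2))))
    (fun p => g p.1) (fun p => hg _) (by
      rintro ⟨x, y⟩ hxy
      rcases exists_of_subdivide_adj hs (mem_adjPairs.1 hxy) with
        ⟨p, hp, rfl, rfl⟩ | ⟨e, k, ⟨rfl, rfl⟩ | ⟨rfl, rfl⟩⟩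
      · exact ⟨Sum.inl p, by simpa using hp, rfl⟩
      · exact ⟨Sum.inr (Sum.inl (e, k)), by simp, rfl⟩
      · exact ⟨Sum.inr (Sum.inr (e, k)), by simp, rfl⟩)
  simp only [Finset.sum_disjSum, Sum.elim_inl, Sum.elim_inr, Fintype.sum_prod_type] at hcover
  simp only [Finset.sum_range, Finset.sum_add_distrib]
  refine hcover.trans (add_le_add (Finset.sum_le_sum_of_subset_of_nonneg
    (Finset.filter_subset _ _) fun _ _ _ => hg _) le_rfl)

lemma sum_adjPairs_le_of_split (φ : Fin N → Fin N → ℝ) (hφ : ∀ u v, 0 ≤ φ u v)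
    (hsymm : ∀ u v, φ u v = φ v u) :
    ∑ p ∈ adjPairs G, φ p.1 p.2
      ≤ ∑ p ∈ unsplitPairs G F, φ p.1 p.2 + 2 * ∑ e : {p // p ∈ F}, φ e.1.1 e.1.2 := by
  have hcover := sum_le_sum_of_cover (adjPairs G)
    ((unsplitPairs G F).disjSum
      ((Finset.univ : Finset {p // p ∈ F}).disjSum (Finset.univ : Finset {p // p ∈ F})))
    (Sum.elim id (Sum.elim (fun e => e.1) (fun e => e.1.swap)))
    (fun p => φ p.1 p.2) (fun p => hφ _ _) (by
      intro p hp
      by_cases h1 : p ∈ F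
      · exact ⟨Sum.inr (Sum.inl ⟨p, h1⟩), by simp, rfl⟩
      by_cases h2 : p.swap ∈ F
      · exact ⟨Sum.inr (Sum.inr ⟨p.swap, h2⟩), by simp, rfl⟩
      · exact ⟨Sum.inl p, by simp [unsplitPairs, hp, h1, h2], rfl⟩)
  simp only [Finset.sum_disjSum, Sum.elim_inl, Sum.elim_inr, id, Prod.fst_swap,
    Prod.snd_swap] at hcover
  rw [Finset.sum_congr rfl fun (e : {p // p ∈ F}) _ => hsymm e.1.2 e.1.1, ← two_mul] at hcover
  exact hcover

lemma sum_unsplitPairs_le (φ : (Fin N ⊕ ({p // p ∈ F} × Fin (s - 1))) →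
      (Fin N ⊕ ({p // p ∈ F} × Fin (s - 1))) → ℝ) (hφ : ∀ x y, 0 ≤ φ x y) :
    ∑ p ∈ unsplitPairs G F, φ (Sum.inl p.1) (Sum.inl p.2)
      ≤ ∑ p ∈ adjPairs (subdivide G F s), φ p.1 p.2 := by
  refine sum_le_sum_of_injOn_mapsTo _ _ (fun p : Fin N × Fin N => (Sum.inl p.1, Sum.inl p.2))
    (fun p => φ p.1 p.2) (fun p => hφ _ _) (fun p hp => ?_) fun p _ q _ h => ?_
  · simp only [unsplitPairs, Finset.mem_filter, mem_adjPairs] at hp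
    rw [mem_adjPairs, subdivide, SimpleGraph.fromRel_adj]
    refine ⟨fun h => hp.1.ne (Sum.inl.inj h), Or.inl ⟨hp.1, fun h => ?_⟩⟩
    rcases h with h | h
    · exact absurd h hp.2.1
    · exact absurd h hp.2.2
  · simp only [Prod.mk.injEq, Sum.inl.injEq] at h
    exact Prod.ext h.1 h.2

lemma sum_subdivPath_le (hF : ∀ p ∈ F, G.Adj p.1 p.2)
    (φ : (Fin N ⊕ ({p // p ∈ F} × Fin (s - 1))) →
      (Fin N ⊕ ({p // p ∈ F} × Fin (s - 1))) → ℝ) (hφ : ∀ x y, 0 ≤ φ x y) :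
    ∑ e : {p // p ∈ F}, ∑ k ∈ Finset.range s, φ (subdivPath F s e k) (subdivPath F s e (k + 1))
      ≤ ∑ p ∈ adjPairs (subdivide G F s), φ p.1 p.2 := by
  rw [← Finset.sum_product']
  refine sum_le_sum_of_injOn_mapsTo _ _
    (fun q : {p // p ∈ F} × ℕ => (subdivPath F s q.1 q.2, subdivPath F s q.1 (q.2 + 1)))
    (fun p => φ p.1 p.2) (fun p => hφ _ _) (fun q hq => ?_) ?_
  · exact mem_adjPairs.2 (subdivide_adj_subdivPath hF q.1 (by simpa using hq))
  · rintro ⟨e, k⟩ hk ⟨e', k'⟩ hk' h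
    have hks : k < s := by simpa using hk
    have hks' : k' < s := by simpa using hk'
    simp only [Prod.mk.injEq] at h
    obtain ⟨h1, h2⟩ := h
    rcases subdivPath_cases e hks with ⟨a1, a2⟩ | ⟨i, a1, a2⟩ <;>
    rcases subdivPath_cases e' hks' with ⟨b1, b2⟩ | ⟨i', b1, b2⟩ <;>
    rcases subdivPath_succ_cases e hks with ⟨c1, c2⟩ | ⟨j, c1, c2⟩ <;>
    rcases subdivPath_succ_cases e' hks' with ⟨d1, d2⟩ | ⟨j', d1, d2⟩ <;>
    rw [a2, b2] at h1 <;> rw [c2, d2] at h2 <;>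
    simp only [Sum.inl.injEq, Sum.inr.injEq, Prod.mk.injEq, reduceCtorEq] at h1 h2
    · exact Prod.ext (Subtype.ext (Prod.ext h1 h2)) (a1.trans b1.symm)
    · exact Prod.ext h2.1 (a1.trans b1.symm)
    · exact Prod.ext h1.1 (by simp only [a1, b1, h1.2])
    · exact Prod.ext h1.1 (by simp only [a1, b1, h1.2])

/-- A Poincaré inequality for `G` yields one for the subdivided graph, with constant of order
`s ^ 2`. -/
lemma subdivide_poincare (hs : 1 ≤ s) (hF : ∀ p ∈ F, G.Adj p.1 p.2) {B : ℝ} (hB : 0 ≤ B)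
    (f : Fin N ⊕ ({p // p ∈ F} × Fin (s - 1)) → ℝ) (a : ℝ)
    (hG : ∑ p ∈ adjPairs G, (f (Sum.inl p.1) - a) ^ 2
      ≤ B * ∑ p ∈ adjPairs G, (f (Sum.inl p.1) - f (Sum.inl p.2)) ^ 2) :
    ∑ p ∈ adjPairs (subdivide G F s), (f p.1 - a) ^ 2
      ≤ (15 * B + 4) * s ^ 2 * ∑ p ∈ adjPairs (subdivide G F s), (f p.1 - f p.2) ^ 2 := by
  have hs' : (1 : ℝ) ≤ s := by exact_mod_cast hs
  set D := ∑ p ∈ adjPairs (subdivide G F s), (f p.1 - f p.2) ^ 2 with hD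
  set Q := ∑ p ∈ adjPairs G, (f (Sum.inl p.1) - a) ^ 2 with hQ
  set E : {p // p ∈ F} → ℝ := fun e => ∑ k ∈ Finset.range s,
    (f (subdivPath F s e k) - f (subdivPath F s e (k + 1))) ^ 2 with hE
  have hD0 : 0 ≤ D := Finset.sum_nonneg fun _ _ => sq_nonneg _
  have hED : ∑ e, E e ≤ D := sum_subdivPath_le hF (fun x y => (f x - f y) ^ 2)
    fun _ _ => sq_nonneg _
  have hpath : ∀ (e : {p // p ∈ F}) (k : ℕ), k ≤ s →
      (f (subdivPath F s e k) - f (Sum.inl e.1.1)) ^ 2 ≤ s * E e := fun e k hk =>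
    sq_sub_le_mul_sum_sq (fun k => f (subdivPath F s e k)) hk
  have hDG : ∑ p ∈ adjPairs G, (f (Sum.inl p.1) - f (Sum.inl p.2)) ^ 2 ≤ 3 * s * D := by
    have h1 := sum_adjPairs_le_of_split (G := G) (F := F)
      (fun u v => (f (Sum.inl u) - f (Sum.inl v)) ^ 2) (fun _ _ => sq_nonneg _)
      (fun _ _ => by ring)
    have h2 := sum_unsplitPairs_le (G := G) (F := F) (s := s) (fun x y => (f x - f y) ^ 2)
      fun _ _ => sq_nonneg _
    have h3 : ∑ e : {p // p ∈ F}, (f (Sum.inl e.1.1) - f (Sum.inl e.1.2)) ^ 2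
        ≤ s * ∑ e, E e := by
      rw [Finset.mul_sum]
      refine Finset.sum_le_sum fun e _ => ?_
      have := hpath e s le_rfl
      rw [subdivPath_last hs] at this
      linarith [sq_nonneg (f (Sum.inl e.1.1) - f (Sum.inl e.1.2)),
        sub_sq_comm (f (Sum.inl e.1.1)) (f (Sum.inl e.1.2))]
    nlinarith [mul_le_mul_of_nonneg_left hED (zero_le_one.trans hs'),
      mul_le_mul_of_nonneg_right hs' hD0]
  have hFQ : ∑ e : {p // p ∈ F}, (f (Sum.inl e.1.1) - a) ^ 2 ≤ Q :=
    sum_le_sum_of_injOn_mapsTo _ _ (fun e : {p // p ∈ F} => e.1)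
      (fun p : Fin N × Fin N => (f (Sum.inl p.1) - a) ^ 2) (fun _ => sq_nonneg _)
      (fun e _ => mem_adjPairs.2 (hF e.1 e.2)) Subtype.val_injective.injOn
  have hpt : ∀ (e : {p // p ∈ F}) (k : ℕ), k ≤ s → (f (subdivPath F s e k) - a) ^ 2
      ≤ 2 * (f (Sum.inl e.1.1) - a) ^ 2 + 2 * (s * E e) := fun e k hk => by
    nlinarith [hpath e k hk, sq_nonneg ((f (subdivPath F s e k) - f (Sum.inl e.1.1))
      - (f (Sum.inl e.1.1) - a))]
  have hpaths : ∑ e : {p // p ∈ F}, ∑ k ∈ Finset.range s,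
      ((f (subdivPath F s e k) - a) ^ 2 + (f (subdivPath F s e (k + 1)) - a) ^ 2)
      ≤ 4 * s * Q + 4 * s ^ 2 * D := by
    calc _ ≤ ∑ e : {p // p ∈ F}, ∑ _k ∈ Finset.range s,
          (4 * (f (Sum.inl e.1.1) - a) ^ 2 + 4 * (s * E e)) := by
          refine Finset.sum_le_sum fun e _ => Finset.sum_le_sum fun k hk => ?_
          have hk' := Finset.mem_range.1 hk
          linarith [hpt e k hk'.le, hpt e (k + 1) hk']
      _ = 4 * s * ∑ e : {p // p ∈ F}, (f (Sum.inl e.1.1) - a) ^ 2 + 4 * s ^ 2 * ∑ e, E e := by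
          simp only [Finset.sum_const, Finset.card_range, nsmul_eq_mul, Finset.mul_sum,
            ← Finset.sum_add_distrib]
          exact Finset.sum_congr rfl fun e _ => by ring
      _ ≤ _ := by gcongr
  have hsum := sum_subdivide_le (G := G) (F := F) hs (fun x => (f x - a) ^ 2)
    fun _ => sq_nonneg _
  have hQD : Q ≤ B * (3 * s * D) := hG.trans (mul_le_mul_of_nonneg_left hDG hB)
  have hBD : 0 ≤ B * (s * D) := by positivity
  calc _ ≤ Q + (4 * s * Q + 4 * s ^ 2 * D) := hsum.trans (add_le_add le_rfl hpaths)
    _ = (1 + 4 * s) * Q + 4 * s ^ 2 * D := by ring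
    _ ≤ (5 * s) * (B * (3 * s * D)) + 4 * s ^ 2 * D := by
        gcongr
        linarith
    _ = _ := by ring

end Subdivision

/-- **Lemma 6.5 (i).** If `G` is a `c`-lazy expander and `H` is obtained from `G` by
stretching some of its edges by a factor `s`, then `t_rel(H) = O(s²)`, with the implied
constant depending only on `c`. -/
theorem trel_of_stretched_expander (c : ℝ) (hc : 0 < c) :
    ∃ C : ℝ, 0 < C ∧
      ∀ (N : ℕ) (G : SimpleGraph (Fin N)), G.Connected → c < lazyCheeger G →
        ∀ s : ℕ, 1 ≤ s →
          ∀ F : Finset (Fin N × Fin N),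
            (∀ p ∈ F, G.Adj p.1 p.2) →
            (∀ p ∈ F, (p.2, p.1) ∉ F) →
            trelG (subdivide G F s) ≤ C * (s : ℝ) ^ 2 := by
  refine ⟨4 * (15 * ((2 * c) ^ 2)⁻¹ + 4), by positivity, ?_⟩
  intro N G hconn hG s hs F hF _
  have hs' : (1 : ℝ) ≤ (s : ℝ) ^ 2 := one_le_pow₀ (by exact_mod_cast hs)
  have hB : 0 ≤ ((2 * c) ^ 2)⁻¹ := by positivity
  rw [mul_assoc]
  refine trelG_le_of_poincare _ (by nlinarith) fun f => ?_
  have := hconn.nonempty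
  obtain ⟨a, ha⟩ := exists_poincare_of_isoperimetric (adjWeight G) (adjWeight_comm G)
    (adjWeight_nonneg G) (show 0 < 2 * c by positivity)
    (isoperimetric_of_le_lazyCheeger G hG.le) (fun v => f (Sum.inl v))
  refine ⟨a, ?_⟩
  rw [← le_inv_mul_iff₀ (by positivity)] at ha
  simp only [sum_adjWeight_mul G fun v _ => (f (Sum.inl v) - a) ^ 2,
    sum_adjWeight_mul G fun v u => (f (Sum.inl v) - f (Sum.inl u)) ^ 2] at ha
  rw [sum_adjWeight_mul _ fun v _ => (f v - a) ^ 2, sum_adjWeight_mul _ fun v u => (f v - f u) ^ 2]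
  exact subdivide_poincare hs hF hB f a ha

end
end

section
/- For the biased birth-and-death chain of Example 3.3, there exist absolute constants c, C > 0 such that for every δ ∈ (0,1/2) and all sufficiently large n: c·√δ·n ≤ 12n − t_δ ≤ C·√δ·n and c·√δ·n ≤ 6n − τ_δ ≤ C·√δ·n. -/
open Filter Finset

noncomputable section

variable {V : Type} [Fintype V] [DecidableEq V]

/-! ### The biased birth-and-death chain of Example 3.3 -/

/-- the neighbor of state `m` in the direction of `z`
(states `0 = z`, `1, …, n` is the `a`-branch, `n+1, …, 2n` is the `b`-branch). -/
def exDown (n m : ℕ) : ℕ := if m = n + 1 then 0 else m - 1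

/-- the transition matrix of the chain of Example 3.3: a birth and death chain on
`{a_n, …, a_1, z, b_1, …, b_n}` with a fixed bias `2/3` towards the middle state `z`. -/
def exP (n : ℕ) : Matrix (Fin (2*n+1)) (Fin (2*n+1)) ℝ :=
  Matrix.of fun i j =>
    if i.val = 0 then (if j.val = 1 ∨ j.val = n + 1 then 1/2 else 0)
    else if i.val = n ∨ i.val = 2*n then (if j.val = exDown n i.val then 1 else 0)
    else if j.val = exDown n i.val then 2/3
    else if j.val = i.val + 1 then 1/3
    else 0

/-- the state `z` -/
def exZ (n : ℕ) : Fin (2*n+1) := ⟨0, by omega⟩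
/-- the state `a = a_n` -/
def exA (n : ℕ) : Fin (2*n+1) := ⟨n, by omega⟩
/-- the state `b = b_n` -/
def exB (n : ℕ) : Fin (2*n+1) := ⟨2*n, by omega⟩

/-- `P[T_z^{a,b} ≤ t]`: the distribution function of the sum of the hitting times of `z` of
two independent lazy chains started at `a` and at `b`. -/
def exCDFd (n : ℕ) (t : ℕ) : ℝ :=
  ∑ k ∈ Finset.range (t+1), ∑ j ∈ Finset.range (t+1-k),
    firstHit (lazyM (exP n)) (exA n) (exZ n) k * firstHit (lazyM (exP n)) (exB n) (exZ n) j

/-- `t_δ = min {t : P[T_z^{a,b} ≤ t] ≥ 2^{-δn}}` -/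
def tdelta (n : ℕ) (δ : ℝ) : ℕ :=
  sInf {t : ℕ | (2 : ℝ) ^ (-(δ * n)) ≤ exCDFd n t}

/-- `P[τ_z > t]` for the continuous-time chain started at `x`:
`Σ_{w ≠ z} [exp(tA)]_{x,w}` where `A` is the restriction of `P - I` to the complement of `z`. -/
def exSurv (n : ℕ) (x : Fin (2*n+1)) (t : ℝ) : ℝ :=
  if h : x = exZ n then 0
  else ∑ w : {w : Fin (2*n+1) // w ≠ exZ n}, heatRestr (exP n) (exZ n) t ⟨x, h⟩ w

/-- the density of the hitting time of `z` for the continuous-time chain started at `x`: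
`f(s) = Σ_{w ≠ z} [exp(sA)]_{x,w} P(w,z)`. -/
def exDens (n : ℕ) (x : Fin (2*n+1)) (s : ℝ) : ℝ :=
  if h : x = exZ n then 0
  else ∑ w : {w : Fin (2*n+1) // w ≠ exZ n},
    heatRestr (exP n) (exZ n) s ⟨x, h⟩ w * exP n w.1 (exZ n)

/-- `P[τ_z^{a,b} ≤ t]`: the distribution function of the sum of the hitting times of `z` of
two independent continuous-time chains started at `a` and at `b`. -/
def exCDFc (n : ℕ) (t : ℝ) : ℝ :=
  ∫ s in (0:ℝ)..t, exDens n (exA n) s * (1 - exSurv n (exB n) (t - s))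

/-- `τ_δ = inf {t ≥ 0 : P[τ_z^{a,b} ≤ t] ≥ 2^{-δn}}` -/
def taudelta (n : ℕ) (δ : ℝ) : ℝ :=
  sInf {t : ℝ | 0 ≤ t ∧ (2 : ℝ) ^ (-(δ * n)) ≤ exCDFc n t}


theorem pathProb_cons {W : Type} (P : Matrix W W ℝ) {k : ℕ} (x : W) (w : Fin (k+1) → W) :
    pathProb P (Fin.cons x w : Fin (k+1+1) → W) = P x (w 0) * pathProb P w := by
  simp [pathProb, Fin.prod_univ_succ (n := k)]

theorem firstHit_zero (P : Matrix V V ℝ) (x y : V) :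
    firstHit P x y 0 = if x = y then 1 else 0 := by
  unfold firstHit
  rw [← (Equiv.funUnique (Fin 1) V).symm.sum_comp]
  simp [pathProb, ite_and]

theorem firstHit_self_succ (P : Matrix V V ℝ) (y : V) (k : ℕ) :
    firstHit P y y (k + 1) = 0 := by
  unfold firstHit
  refine Finset.sum_eq_zero fun w _ => if_neg ?_
  rintro ⟨h0, -, h⟩
  exact h 0 (by simpa using h0)

theorem firstHit_succ (P : Matrix V V ℝ) {x y : V} (hxy : x ≠ y) (k : ℕ) :
    firstHit P x y (k + 1) = ∑ v, P x v * firstHit P v y k := by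
  unfold firstHit
  rw [← (Fin.consEquiv (fun _ => V)).sum_comp, Fintype.sum_prod_type,
    Finset.sum_eq_single x _ (by simp)]
  · simp_rw [Finset.mul_sum]
    rw [Finset.sum_comm]
    refine Finset.sum_congr rfl fun w _ => ?_
    rw [Finset.sum_eq_single (w 0) (fun v _ hv => by rw [if_neg fun h => hv h.1.symm, mul_zero])
      (by simp)]
    simp only [Fin.consEquiv_apply, Fin.cons_zero, true_and, Fin.forall_fin_succ (n := k),
      Fin.castSucc_zero, ← Fin.succ_castSucc, Fin.cons_succ, ← Fin.succ_last, ne_eq, hxy,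
      not_false_eq_true, mul_ite, mul_zero]
    rw [← pathProb_cons]
    rfl
  · intro v _ hv
    exact Finset.sum_eq_zero fun w _ => if_neg fun h => hv (by simpa using h.1)

theorem firstHit_nonneg {P : Matrix V V ℝ} (hP : ∀ i j, 0 ≤ P i j) (x y : V) (k : ℕ) :
    0 ≤ firstHit P x y k := by
  refine Finset.sum_nonneg fun w _ => ?_
  split_ifs
  · exact Finset.prod_nonneg fun i _ => hP _ _
  · exact le_rfl

/-- The generating function of the hitting time of `y`, truncated at time `t`. -/
def hitGen (P : Matrix V V ℝ) (y : V) (θ : ℝ) (t : ℕ) (x : V) : ℝ :=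
  ∑ k ∈ Finset.range (t + 1), θ ^ k * firstHit P x y k

theorem hitGen_self (P : Matrix V V ℝ) (y : V) (θ : ℝ) (t : ℕ) : hitGen P y θ t y = 1 := by
  simp [hitGen, Finset.sum_range_succ', firstHit_self_succ, firstHit_zero]

theorem hitGen_zero (P : Matrix V V ℝ) {x y : V} (hxy : x ≠ y) (θ : ℝ) :
    hitGen P y θ 0 x = 0 := by
  simp [hitGen, firstHit_zero, hxy]

theorem hitGen_succ (P : Matrix V V ℝ) {x y : V} (hxy : x ≠ y) (θ : ℝ) (t : ℕ) :
    hitGen P y θ (t + 1) x = θ * ∑ v, P x v * hitGen P y θ t v := by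
  unfold hitGen
  rw [Finset.sum_range_succ']
  simp only [firstHit_succ P hxy, firstHit_zero, if_neg hxy, mul_zero, add_zero, Finset.mul_sum]
  rw [Finset.sum_comm]
  refine Finset.sum_congr rfl fun v _ => Finset.sum_congr rfl fun k _ => ?_
  ring

/-- A nonnegative supersolution dominates the generating function of the hitting time. -/
theorem hitGen_le {P : Matrix V V ℝ} (hP : ∀ i j, 0 ≤ P i j) {y : V} {θ : ℝ} (hθ : 0 ≤ θ)
    {w : V → ℝ} (hw : ∀ x, 0 ≤ w x) (hy : 1 ≤ w y)
    (h : ∀ x, x ≠ y → θ * ∑ v, P x v * w v ≤ w x) (t : ℕ) (x : V) :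
    hitGen P y θ t x ≤ w x := by
  induction t generalizing x with
  | zero =>
    rcases eq_or_ne x y with rfl | hx
    · rwa [hitGen_self]
    · rw [hitGen_zero P hx]; exact hw x
  | succ t ih =>
    rcases eq_or_ne x y with rfl | hx
    · rwa [hitGen_self]
    · rw [hitGen_succ P hx]
      refine le_trans ?_ (h x hx)
      gcongr with v
      · exact hP _ _
      · exact ih v

/-- A subsolution bounded by `1` is dominated by the generating function, up to the mass
that has not yet been absorbed. -/
theorem le_hitGen_add {P : Matrix V V ℝ} (hP : ∀ i j, 0 ≤ P i j) {y : V}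
    (hrow : ∀ x, x ≠ y → ∑ v, P x v ≤ 1) {θ : ℝ} (hθ : 0 ≤ θ)
    {w : V → ℝ} (hw : ∀ x, w x ≤ 1)
    (h : ∀ x, x ≠ y → w x ≤ θ * ∑ v, P x v * w v) (t : ℕ) (x : V) :
    w x ≤ hitGen P y θ t x + θ ^ t := by
  induction t generalizing x with
  | zero =>
    rcases eq_or_ne x y with rfl | hx
    · rw [hitGen_self]; linarith [hw x]
    · rw [hitGen_zero P hx]; simpa using hw x
  | succ t ih =>
    rcases eq_or_ne x y with rfl | hx
    · rw [hitGen_self]; linarith [hw x, pow_nonneg hθ (t + 1)]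
    · rw [hitGen_succ P hx]
      calc w x ≤ θ * ∑ v, P x v * w v := h x hx
        _ ≤ θ * ∑ v, P x v * (hitGen P y θ t v + θ ^ t) := by
          gcongr with v
          · exact hP _ _
          · exact ih v
        _ = θ * ∑ v, P x v * hitGen P y θ t v + θ ^ (t + 1) * ∑ v, P x v := by
          simp_rw [mul_add, Finset.sum_add_distrib, ← Finset.sum_mul]; ring
        _ ≤ _ := by
          have := mul_le_mul_of_nonneg_left (hrow x hx) (pow_nonneg hθ (t + 1))
          linarith

/-- The distribution function of the sum of two independent hitting times. -/
def hitSumCDF (P : Matrix V V ℝ) (a b y : V) (t : ℕ) : ℝ :=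
  ∑ k ∈ Finset.range (t+1), ∑ j ∈ Finset.range (t+1-k), firstHit P a y k * firstHit P b y j

theorem hitSumCDF_le {P : Matrix V V ℝ} (hP : ∀ i j, 0 ≤ P i j) {a b y : V} {θ A B : ℝ}
    (hθ : 0 < θ) (hθ1 : θ ≤ 1) (t : ℕ) (ha : hitGen P y θ t a ≤ A)
    (hb : hitGen P y θ t b ≤ B) :
    θ ^ t * hitSumCDF P a b y t ≤ A * B := by
  have hn := fun x k => firstHit_nonneg hP x y k
  have h0 : 0 ≤ hitGen P y θ t b :=
    Finset.sum_nonneg fun k _ => mul_nonneg (pow_nonneg hθ.le k) (hn _ _)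
  have h0' : 0 ≤ hitGen P y θ t a :=
    Finset.sum_nonneg fun k _ => mul_nonneg (pow_nonneg hθ.le k) (hn _ _)
  refine le_trans ?_ (mul_le_mul ha hb h0 (h0'.trans ha))
  unfold hitSumCDF hitGen
  rw [Finset.mul_sum, Finset.sum_mul]
  refine Finset.sum_le_sum fun k hk => ?_
  rw [Finset.mul_sum, Finset.mul_sum]
  have hk' : k ≤ t := by simpa [Nat.lt_succ_iff] using hk
  calc ∑ j ∈ Finset.range (t+1-k), θ ^ t * (firstHit P a y k * firstHit P b y j)
      ≤ ∑ j ∈ Finset.range (t+1-k), θ ^ k * firstHit P a y k * (θ ^ j * firstHit P b y j) := by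
        refine Finset.sum_le_sum fun j hj => ?_
        have hj' : k + j ≤ t := by have := Finset.mem_range.1 hj; omega
        have : θ ^ t ≤ θ ^ (k + j) := pow_le_pow_of_le_one hθ.le hθ1 hj'
        calc _ ≤ θ ^ (k + j) * (firstHit P a y k * firstHit P b y j) :=
              mul_le_mul_of_nonneg_right this (mul_nonneg (hn _ _) (hn _ _))
          _ = _ := by rw [pow_add]; ring
    _ ≤ _ := by
        refine Finset.sum_le_sum_of_subset_of_nonneg (Finset.range_mono (by omega)) ?_
        intro j _ _
        exact mul_nonneg (mul_nonneg (pow_nonneg hθ.le _) (hn _ _))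
          (mul_nonneg (pow_nonneg hθ.le _) (hn _ _))

theorem le_hitSumCDF {P : Matrix V V ℝ} (hP : ∀ i j, 0 ≤ P i j) {a b y : V}
    {θ θ' L A B M : ℝ} (hθ : 0 < θ) (hθ' : 0 < θ') (hM : 0 < M)
    (hsq : θ ^ 2 ≤ θ') (hL : 0 ≤ L) (hL1 : L ≤ 1) (t : ℕ)
    (ha : L ≤ hitGen P y θ t a + θ ^ t) (ha1 : hitGen P y 1 t a ≤ 1)
    (hb : ∀ u, L ≤ hitGen P y θ u b + θ ^ u)
    (ha' : hitGen P y θ' t a ≤ A) (hb' : ∀ u, hitGen P y θ' u b ≤ B) (hB : 0 ≤ B) :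
    L ^ 2 - 2 * θ ^ t - A * B / M ≤ M * hitSumCDF P a b y t := by
  have hn := fun x k => firstHit_nonneg hP x y k
  have key : ∀ m : ℕ, θ ^ m ≤ M + θ' ^ m / M := by
    intro m
    have h1 : (θ ^ m) ^ 2 ≤ θ' ^ m := by
      rw [← pow_mul, mul_comm, pow_mul]; gcongr
    have h2 : 0 < θ ^ m := pow_pos hθ m
    rw [← sub_nonneg]
    have : M + θ' ^ m / M - θ ^ m = (M ^ 2 + θ' ^ m - θ ^ m * M) / M := by field_simp
    rw [this]
    apply div_nonneg _ hM.le
    nlinarith [sq_nonneg (M - θ ^ m), mul_pos h2 hM]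
  have inner : ∀ k ∈ Finset.range (t + 1), θ ^ k * L ≤
      M * ∑ j ∈ Finset.range (t+1-k), firstHit P b y j + θ' ^ k * B / M + θ ^ t := by
    intro k hk
    have hk' : k ≤ t := by simpa [Nat.lt_succ_iff] using hk
    have e : t + 1 - k = (t - k) + 1 := by omega
    have h1 : θ ^ k * L ≤ θ ^ k * hitGen P y θ (t - k) b + θ ^ t := by
      have := mul_le_mul_of_nonneg_left (hb (t - k)) (pow_nonneg hθ.le k)
      rw [mul_add, ← pow_add, Nat.add_sub_cancel' hk'] at this
      exact this
    have h2 : θ ^ k * hitGen P y θ (t - k) b ≤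
        M * ∑ j ∈ Finset.range (t+1-k), firstHit P b y j +
          θ' ^ k * hitGen P y θ' (t - k) b / M := by
      unfold hitGen
      rw [e, Finset.mul_sum, Finset.mul_sum, Finset.mul_sum, Finset.sum_div,
        ← Finset.sum_add_distrib]
      refine Finset.sum_le_sum fun j _ => ?_
      have := mul_le_mul_of_nonneg_right (key (k + j)) (hn b j)
      rw [pow_add, pow_add] at this
      calc _ = θ ^ k * θ ^ j * firstHit P b y j := by ring
        _ ≤ _ := this
        _ = _ := by ring
    have h3 : θ' ^ k * hitGen P y θ' (t - k) b / M ≤ θ' ^ k * B / M := by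
      gcongr
      exact hb' _
    linarith
  have sum : L * hitGen P y θ t a ≤
      M * hitSumCDF P a b y t + B / M * hitGen P y θ' t a + θ ^ t * hitGen P y 1 t a := by
    unfold hitSumCDF hitGen
    simp_rw [Finset.mul_sum, ← Finset.sum_add_distrib]
    refine Finset.sum_le_sum fun k hk => ?_
    have := mul_le_mul_of_nonneg_right (inner k hk) (hn a k)
    simp_rw [← Finset.mul_sum]
    calc _ = θ ^ k * L * firstHit P a y k := by ring
      _ ≤ _ := this
      _ = _ := by ring
  have h4 : B / M * hitGen P y θ' t a ≤ A * B / M := by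
    calc _ ≤ B / M * A := by gcongr
      _ = _ := by ring
  have h5 := mul_le_mul_of_nonneg_left ha1 (pow_nonneg hθ.le t)
  have h6 := mul_le_mul_of_nonneg_left ha hL
  have h7 := mul_le_mul_of_nonneg_right hL1 (pow_nonneg hθ.le t)
  nlinarith

section heat

open scoped Matrix.Norms.Operator

theorem heatRestr_eq_exp (P : Matrix V V ℝ) (y : V) (t : ℝ) :
    heatRestr P y t = NormedSpace.exp (t • restrQ P y) := by
  rw [NormedSpace.exp_eq_tsum ℝ]
  unfold heatRestr
  refine tsum_congr fun k => ?_
  rw [smul_pow, smul_smul]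
  congr 1
  ring

theorem hasDerivAt_heatRestr (P : Matrix V V ℝ) (y : V) (t : ℝ) :
    HasDerivAt (heatRestr P y) (heatRestr P y t * restrQ P y) t := by
  have := hasDerivAt_exp_smul_const (𝕂 := ℝ) (restrQ P y) t
  rw [heatRestr_eq_exp]
  exact this.congr_of_eventuallyEq (.of_forall fun s => heatRestr_eq_exp P y s)

theorem hasDerivAt_heatRestr_apply (P : Matrix V V ℝ) (y : V) (t : ℝ) (i j : {w : V // w ≠ y}) :
    HasDerivAt (fun s => heatRestr P y s i j) ((heatRestr P y t * restrQ P y) i j) t := by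
  have h := hasDerivAt_heatRestr P y t
  exact hasDerivAt_pi.1 (hasDerivAt_pi.1 h i) j

theorem heatRestr_zero (P : Matrix V V ℝ) (y : V) : heatRestr P y 0 = 1 := by
  rw [heatRestr_eq_exp, zero_smul, NormedSpace.exp_zero]

theorem exp_apply_nonneg {ι : Type*} [Fintype ι] [DecidableEq ι] {Q : Matrix ι ι ℝ}
    (hQ : ∀ i j, 0 ≤ Q i j) (i j : ι) : 0 ≤ NormedSpace.exp Q i j := by
  have hpow : ∀ (k : ℕ) (i j : ι), 0 ≤ (Q ^ k) i j := by
    intro k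
    induction k with
    | zero => intro i j; rw [pow_zero, Matrix.one_apply]; split_ifs <;> norm_num
    | succ k ih =>
      intro i j
      rw [pow_succ, Matrix.mul_apply]
      exact Finset.sum_nonneg fun l _ => mul_nonneg (ih _ _) (hQ _ _)
  have hs := NormedSpace.exp_series_hasSum_exp' (𝕂 := ℝ) Q
  have hs' := Pi.hasSum.1 (Pi.hasSum.1 hs i) j
  refine hs'.nonneg fun k => ?_
  exact mul_nonneg (by positivity) (hpow k i j)

theorem heatRestr_nonneg {P : Matrix V V ℝ} (hP : ∀ i j, 0 ≤ P i j) (y : V) {t : ℝ}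
    (ht : 0 ≤ t) (i j : {w : V // w ≠ y}) : 0 ≤ heatRestr P y t i j := by
  set Q : Matrix {w : V // w ≠ y} {w : V // w ≠ y} ℝ := Matrix.of fun a b => P a.1 b.1 with hQ
  have hA : t • restrQ P y = (-t) • (1 : Matrix {w : V // w ≠ y} {w : V // w ≠ y} ℝ) + t • Q := by
    ext a b
    simp [restrQ, hQ, Matrix.one_apply, mul_sub]
    ring
  have hexp : NormedSpace.exp ((-t) • (1 : Matrix {w : V // w ≠ y} {w : V // w ≠ y} ℝ)) =
      Real.exp (-t) • (1 : Matrix {w : V // w ≠ y} {w : V // w ≠ y} ℝ) := by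
    rw [← Algebra.algebraMap_eq_smul_one, ← Algebra.algebraMap_eq_smul_one,
      Real.exp_eq_exp_ℝ]
    exact (NormedSpace.algebraMap_exp_comm (-t)).symm
  rw [heatRestr_eq_exp, hA, Matrix.exp_add_of_commute _ _
    ((Commute.one_left _).smul_left _), hexp, smul_one_mul, Matrix.smul_apply]
  exact mul_nonneg (Real.exp_pos _).le
    (exp_apply_nonneg (fun a b => mul_nonneg ht (hP _ _)) _ _)

end heat

theorem restrQ_mulVec (P : Matrix V V ℝ) (y : V) (w : V → ℝ) (x : {w : V // w ≠ y}) :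
    (restrQ P y).mulVec (fun v => w v.1) x = ∑ v, P x.1 v * w v - P x.1 y * w y - w x.1 := by
  rw [Fintype.sum_eq_add_sum_subtype_ne _ y]
  simp [Matrix.mulVec, dotProduct, restrQ, sub_mul, Finset.sum_sub_distrib]

theorem hasDerivAt_heatRestr_mulVec (P : Matrix V V ℝ) (y : V) (w : {w : V // w ≠ y} → ℝ)
    (x : {w : V // w ≠ y}) (s : ℝ) :
    HasDerivAt (fun s => (heatRestr P y s).mulVec w x)
      ((heatRestr P y s).mulVec ((restrQ P y).mulVec w) x) s := by
  rw [Matrix.mulVec_mulVec]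
  exact HasDerivAt.fun_sum fun j _ => (hasDerivAt_heatRestr_apply P y s x j).mul_const _

theorem continuous_heatRestr_mulVec (P : Matrix V V ℝ) (y : V) (w : {w : V // w ≠ y} → ℝ)
    (x : {w : V // w ≠ y}) : Continuous fun s => (heatRestr P y s).mulVec w x :=
  continuous_iff_continuousAt.2 fun s => (hasDerivAt_heatRestr_mulVec P y w x s).continuousAt

theorem heatRestr_mulVec_mono {P : Matrix V V ℝ} (hP : ∀ i j, 0 ≤ P i j) (y : V) {s : ℝ}
    (hs : 0 ≤ s) {w w' : {w : V // w ≠ y} → ℝ} (h : ∀ i, w i ≤ w' i) (x : {w : V // w ≠ y}) :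
    (heatRestr P y s).mulVec w x ≤ (heatRestr P y s).mulVec w' x :=
  Finset.sum_le_sum fun i _ => mul_le_mul_of_nonneg_left (h i) (heatRestr_nonneg hP y hs x i)

/-- The density of the hitting time of `y` for the continuous-time chain started at `x`. -/
def hitDens (P : Matrix V V ℝ) (y : V) (x : {w : V // w ≠ y}) (s : ℝ) : ℝ :=
  (heatRestr P y s).mulVec (fun v => P v.1 y) x

theorem continuous_hitDens (P : Matrix V V ℝ) (y : V) (x : {w : V // w ≠ y}) :
    Continuous (hitDens P y x) :=
  continuous_heatRestr_mulVec P y _ x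

theorem hitDens_nonneg {P : Matrix V V ℝ} (hP : ∀ i j, 0 ≤ P i j) (y : V)
    (x : {w : V // w ≠ y}) {s : ℝ} (hs : 0 ≤ s) : 0 ≤ hitDens P y x s :=
  Finset.sum_nonneg fun i _ => mul_nonneg (heatRestr_nonneg hP y hs x i) (hP _ _)

theorem integral_heatRestr_mulVec (P : Matrix V V ℝ) (y : V) (w : V → ℝ)
    (x : {w : V // w ≠ y}) (l u : ℝ) :
    ∫ s in (0:ℝ)..u, Real.exp (-(l * s)) * (heatRestr P y s).mulVec
        (fun v => (1 + l) * w v.1 - ∑ i, P v.1 i * w i + P v.1 y * w y) x =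
      w x.1 - Real.exp (-(l * u)) * (heatRestr P y u).mulVec (fun v => w v.1) x := by
  have hD : ∀ s : ℝ, HasDerivAt
      (fun s => -(Real.exp (-(l * s)) * (heatRestr P y s).mulVec (fun v => w v.1) x))
      (Real.exp (-(l * s)) * (heatRestr P y s).mulVec
        (fun v => (1 + l) * w v.1 - ∑ i, P v.1 i * w i + P v.1 y * w y) x) s := by
    intro s
    have h1 : HasDerivAt (fun s : ℝ => Real.exp (-(l * s))) (Real.exp (-(l * s)) * (-l)) s := by
      have := ((hasDerivAt_id s).const_mul l).neg.exp
      simpa using this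
    refine (h1.mul (hasDerivAt_heatRestr_mulVec P y (fun v => w v.1) x s)).neg.congr_deriv ?_
    have h2 : (fun v : {w : V // w ≠ y} =>
        (1 + l) * w v.1 - ∑ i, P v.1 i * w i + P v.1 y * w y) =
        l • (fun v : {w : V // w ≠ y} => w v.1) - (restrQ P y).mulVec (fun v => w v.1) := by
      funext v
      rw [Pi.sub_apply, restrQ_mulVec, Pi.smul_apply, smul_eq_mul]
      ring
    rw [h2, Matrix.mulVec_sub, Matrix.mulVec_smul, Pi.sub_apply, Pi.smul_apply, smul_eq_mul]
    ring
  rw [intervalIntegral.integral_eq_sub_of_hasDerivAt (fun s _ => hD s)]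
  · simp [heatRestr_zero]
    ring
  · exact ((by fun_prop : Continuous fun s : ℝ => Real.exp (-(l * s))).mul
      (continuous_heatRestr_mulVec P y _ x)).intervalIntegrable _ _

/-- A nonnegative supersolution dominates the Laplace transform of the hitting time. -/
theorem laplace_hitDens_le {P : Matrix V V ℝ} (hP : ∀ i j, 0 ≤ P i j) {y : V} {l : ℝ}
    {w : V → ℝ} (hw : ∀ x, 0 ≤ w x) (hy : 1 ≤ w y)
    (h : ∀ x, x ≠ y → ∑ v, P x v * w v ≤ (1 + l) * w x) (x : {w : V // w ≠ y}) {u : ℝ}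
    (hu : 0 ≤ u) :
    ∫ s in (0:ℝ)..u, Real.exp (-(l * s)) * hitDens P y x s ≤ w x.1 := by
  have hexp : Continuous fun s : ℝ => Real.exp (-(l * s)) := by fun_prop
  calc _ ≤ ∫ s in (0:ℝ)..u, Real.exp (-(l * s)) * (heatRestr P y s).mulVec
        (fun v => (1 + l) * w v.1 - ∑ i, P v.1 i * w i + P v.1 y * w y) x := by
        refine intervalIntegral.integral_mono_on hu
          ((hexp.mul (continuous_hitDens P y x)).intervalIntegrable _ _)
          ((hexp.mul (continuous_heatRestr_mulVec P y _ x)).intervalIntegrable _ _) ?_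
        intro s hs
        refine mul_le_mul_of_nonneg_left ?_ (Real.exp_pos _).le
        refine heatRestr_mulVec_mono hP y hs.1 (fun i => ?_) x
        have h1 := h i.1 i.2
        have h2 := mul_le_mul_of_nonneg_left hy (hP i.1 y)
        linarith
    _ ≤ w x.1 := by
        rw [integral_heatRestr_mulVec]
        have : 0 ≤ (heatRestr P y u).mulVec (fun v => w v.1) x :=
          Finset.sum_nonneg fun i _ => mul_nonneg (heatRestr_nonneg hP y hu x i) (hw _)
        nlinarith [Real.exp_pos (-(l * u)), mul_nonneg (Real.exp_pos (-(l * u))).le this]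

theorem heatRestr_mulVec_one {P : Matrix V V ℝ} {y : V} (hrow : ∀ x, x ≠ y → ∑ v, P x v = 1)
    (x : {w : V // w ≠ y}) (u : ℝ) :
    1 - (heatRestr P y u).mulVec (fun _ => 1) x = ∫ s in (0:ℝ)..u, hitDens P y x s := by
  have := integral_heatRestr_mulVec P y (fun _ => 1) x 0 u
  simp only [zero_mul, neg_zero, Real.exp_zero, one_mul, add_zero, mul_one] at this
  rw [← this]
  refine intervalIntegral.integral_congr fun s _ => ?_
  simp only [hitDens]
  congr 1
  funext v
  rw [hrow v.1 v.2]
  ring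

theorem heatRestr_mulVec_one_le {P : Matrix V V ℝ} (hP : ∀ i j, 0 ≤ P i j) {y : V}
    (hrow : ∀ x, x ≠ y → ∑ v, P x v = 1) (x : {w : V // w ≠ y}) {u : ℝ} (hu : 0 ≤ u) :
    (heatRestr P y u).mulVec (fun _ => 1) x ≤ 1 := by
  have h1 := heatRestr_mulVec_one hrow x u
  have h2 : 0 ≤ ∫ s in (0:ℝ)..u, hitDens P y x s :=
    intervalIntegral.integral_nonneg hu fun s hs => hitDens_nonneg hP y x hs.1
  linarith

/-- A subsolution bounded by `1` is dominated by the Laplace transform of the hitting time, up to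
the mass that has not yet been absorbed. -/
theorem le_laplace_hitDens_add {P : Matrix V V ℝ} (hP : ∀ i j, 0 ≤ P i j) {y : V}
    (hrow : ∀ x, x ≠ y → ∑ v, P x v = 1) {l : ℝ} {w : V → ℝ} (hw : ∀ x, w x ≤ 1)
    (h : ∀ x, x ≠ y → (1 + l) * w x ≤ ∑ v, P x v * w v) (x : {w : V // w ≠ y}) {u : ℝ}
    (hu : 0 ≤ u) :
    w x.1 ≤ (∫ s in (0:ℝ)..u, Real.exp (-(l * s)) * hitDens P y x s) + Real.exp (-(l * u)) := by
  have hexp : Continuous fun s : ℝ => Real.exp (-(l * s)) := by fun_prop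
  have h1 : w x.1 - Real.exp (-(l * u)) * (heatRestr P y u).mulVec (fun v => w v.1) x ≤
      ∫ s in (0:ℝ)..u, Real.exp (-(l * s)) * hitDens P y x s := by
    rw [← integral_heatRestr_mulVec]
    refine intervalIntegral.integral_mono_on hu
      ((hexp.mul (continuous_heatRestr_mulVec P y _ x)).intervalIntegrable _ _)
      ((hexp.mul (continuous_hitDens P y x)).intervalIntegrable _ _) ?_
    intro s hs
    refine mul_le_mul_of_nonneg_left ?_ (Real.exp_pos _).le
    refine heatRestr_mulVec_mono hP y hs.1 (fun i => ?_) x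
    have h1 := h i.1 i.2
    have h2 := mul_le_mul_of_nonneg_left (hw y) (hP i.1 y)
    linarith
  have h2 : (heatRestr P y u).mulVec (fun v => w v.1) x ≤ 1 :=
    (heatRestr_mulVec_mono hP y hu (fun i => hw i.1) x).trans (heatRestr_mulVec_one_le hP hrow x hu)
  have h3 := mul_le_mul_of_nonneg_left h2 (Real.exp_pos (-(l * u))).le
  linarith

theorem integral_conv_le {f h F : ℝ → ℝ} (hf : Continuous f) (hh : Continuous h)
    (hF : Continuous F) (hf0 : ∀ s, 0 ≤ s → 0 ≤ f s) (hh0 : ∀ s, 0 ≤ s → 0 ≤ h s)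
    (hFh : ∀ u, F u = ∫ s in (0:ℝ)..u, h s) {l A B : ℝ} (hl : 0 ≤ l)
    (hA : ∀ u, 0 ≤ u → ∫ s in (0:ℝ)..u, Real.exp (-(l * s)) * f s ≤ A)
    (hB : ∀ u, 0 ≤ u → ∫ s in (0:ℝ)..u, Real.exp (-(l * s)) * h s ≤ B) {t : ℝ} (ht : 0 ≤ t) :
    ∫ s in (0:ℝ)..t, f s * F (t - s) ≤ Real.exp (l * t) * (A * B) := by
  have hexp : Continuous fun s : ℝ => Real.exp (-(l * s)) := by fun_prop
  have hB0 : 0 ≤ B := by simpa using hB 0 le_rfl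
  have hFB : ∀ u, 0 ≤ u → F u ≤ Real.exp (l * u) * B := by
    intro u hu
    rw [hFh]
    calc ∫ s in (0:ℝ)..u, h s
        ≤ ∫ s in (0:ℝ)..u, Real.exp (l * u) * (Real.exp (-(l * s)) * h s) := by
          refine intervalIntegral.integral_mono_on hu (hh.intervalIntegrable _ _)
            (((hexp.mul hh).const_mul _).intervalIntegrable _ _) fun s hs => ?_
          rw [← mul_assoc, ← Real.exp_add]
          refine le_mul_of_one_le_left (hh0 s hs.1) (Real.one_le_exp ?_)
          nlinarith [mul_nonneg hl (sub_nonneg.2 hs.2)]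
      _ ≤ _ := by
          rw [intervalIntegral.integral_const_mul]
          exact mul_le_mul_of_nonneg_left (hB u hu) (Real.exp_pos _).le
  calc ∫ s in (0:ℝ)..t, f s * F (t - s)
      ≤ ∫ s in (0:ℝ)..t, (Real.exp (l * t) * B) * (Real.exp (-(l * s)) * f s) := by
        refine intervalIntegral.integral_mono_on ht
          ((hf.mul (hF.comp (continuous_const.sub continuous_id))).intervalIntegrable _ _)
          (((hexp.mul hf).const_mul _).intervalIntegrable _ _) fun s hs => ?_
        have h1 := mul_le_mul_of_nonneg_left (hFB (t - s) (sub_nonneg.2 hs.2)) (hf0 s hs.1)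
        refine h1.trans (le_of_eq ?_)
        rw [show l * (t - s) = l * t + -(l * s) by ring, Real.exp_add]
        ring
    _ ≤ _ := by
        rw [intervalIntegral.integral_const_mul]
        have := mul_le_mul_of_nonneg_left (hA t ht) (mul_nonneg (Real.exp_pos (l * t)).le hB0)
        linarith

theorem le_integral_conv {f h F : ℝ → ℝ} (hf : Continuous f) (hh : Continuous h)
    (hF : Continuous F) (hf0 : ∀ s, 0 ≤ s → 0 ≤ f s) (hh0 : ∀ s, 0 ≤ s → 0 ≤ h s)
    (hFh : ∀ u, F u = ∫ s in (0:ℝ)..u, h s) {l l' L A B M : ℝ} (hM : 0 < M)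
    (hl : l' ≤ 2 * l) (hL : 0 ≤ L) (hL1 : L ≤ 1)
    (hf1 : ∀ u, 0 ≤ u → ∫ s in (0:ℝ)..u, f s ≤ 1)
    (hfL : ∀ u, 0 ≤ u → L ≤ (∫ s in (0:ℝ)..u, Real.exp (-(l * s)) * f s) + Real.exp (-(l * u)))
    (hhL : ∀ u, 0 ≤ u → L ≤ (∫ s in (0:ℝ)..u, Real.exp (-(l * s)) * h s) + Real.exp (-(l * u)))
    (hA : ∀ u, 0 ≤ u → ∫ s in (0:ℝ)..u, Real.exp (-(l' * s)) * f s ≤ A)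
    (hB : ∀ u, 0 ≤ u → ∫ s in (0:ℝ)..u, Real.exp (-(l' * s)) * h s ≤ B)
    {t : ℝ} (ht : 0 ≤ t) :
    L ^ 2 - 2 * Real.exp (-(l * t)) - A * B / M ≤ M * ∫ s in (0:ℝ)..t, f s * F (t - s) := by
  have hexpf : ∀ l : ℝ, Continuous fun s : ℝ => Real.exp (-(l * s)) * f s :=
    fun l => by fun_prop
  have hexph : ∀ l : ℝ, Continuous fun s : ℝ => Real.exp (-(l * s)) * h s :=
    fun l => by fun_prop
  have hB0 : 0 ≤ B := by simpa using hB 0 le_rfl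
  have key : ∀ v : ℝ, 0 ≤ v →
      Real.exp (-(l * v)) ≤ M + Real.exp (-(l' * v)) / M := by
    intro v hv
    have h1 : Real.exp (-(l * v)) ^ 2 ≤ Real.exp (-(l' * v)) := by
      rw [← Real.exp_nat_mul]
      apply Real.exp_le_exp.2
      push_cast
      nlinarith
    have h2 := Real.exp_pos (-(l * v))
    rw [← sub_nonneg]
    have : M + Real.exp (-(l' * v)) / M - Real.exp (-(l * v)) =
        (M ^ 2 + Real.exp (-(l' * v)) - Real.exp (-(l * v)) * M) / M := by field_simp
    rw [this]
    apply div_nonneg _ hM.le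
    nlinarith [sq_nonneg (M - Real.exp (-(l * v))), mul_pos h2 hM]
  have inner : ∀ s, 0 ≤ s → s ≤ t → Real.exp (-(l * s)) * L ≤
      M * F (t - s) + Real.exp (-(l' * s)) * (B / M) + Real.exp (-(l * t)) := by
    intro s hs hst
    have hu : 0 ≤ t - s := sub_nonneg.2 hst
    have h1 : Real.exp (-(l * s)) * L ≤
        Real.exp (-(l * s)) * (∫ v in (0:ℝ)..(t - s), Real.exp (-(l * v)) * h v) +
          Real.exp (-(l * t)) := by
      have := mul_le_mul_of_nonneg_left (hhL (t - s) hu) (Real.exp_pos (-(l * s))).le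
      rw [mul_add, ← Real.exp_add] at this
      rwa [show -(l * s) + -(l * (t - s)) = -(l * t) by ring] at this
    have h2 : Real.exp (-(l * s)) * (∫ v in (0:ℝ)..(t - s), Real.exp (-(l * v)) * h v) ≤
        M * F (t - s) + Real.exp (-(l' * s)) / M *
          ∫ v in (0:ℝ)..(t - s), Real.exp (-(l' * v)) * h v := by
      rw [hFh, ← intervalIntegral.integral_const_mul, ← intervalIntegral.integral_const_mul,
        ← intervalIntegral.integral_const_mul, ← intervalIntegral.integral_add
          ((hh.const_mul _).intervalIntegrable _ _)
          (((hexph l').const_mul _).intervalIntegrable _ _)]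
      refine intervalIntegral.integral_mono_on hu
        (((hexph l).const_mul _).intervalIntegrable _ _)
        (((hh.const_mul _).add ((hexph l').const_mul _)).intervalIntegrable _ _)
        fun v hv => ?_
      have := mul_le_mul_of_nonneg_right (key (s + v) (add_nonneg hs hv.1)) (hh0 v hv.1)
      rw [show -(l * (s + v)) = -(l * s) + -(l * v) by ring,
        show -(l' * (s + v)) = -(l' * s) + -(l' * v) by ring, Real.exp_add, Real.exp_add] at this
      calc _ = Real.exp (-(l * s)) * Real.exp (-(l * v)) * h v := by ring
        _ ≤ _ := this
        _ = _ := by ring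
    have h3 := mul_le_mul_of_nonneg_left (hB (t - s) hu)
      (div_pos (Real.exp_pos (-(l' * s))) hM).le
    have h4 : Real.exp (-(l' * s)) / M * B = Real.exp (-(l' * s)) * (B / M) := by ring
    linarith
  have hcF : Continuous fun s => f s * F (t - s) :=
    hf.mul (hF.comp (continuous_const.sub continuous_id))
  have hcS : Continuous fun s => M * (f s * F (t - s)) + B / M * (Real.exp (-(l' * s)) * f s) :=
    (hcF.const_mul _).add ((hexpf l').const_mul _)
  have sum : L * (∫ s in (0:ℝ)..t, Real.exp (-(l * s)) * f s) ≤
      M * (∫ s in (0:ℝ)..t, f s * F (t - s)) +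
        B / M * (∫ s in (0:ℝ)..t, Real.exp (-(l' * s)) * f s) +
        Real.exp (-(l * t)) * ∫ s in (0:ℝ)..t, f s := by
    rw [← intervalIntegral.integral_const_mul, ← intervalIntegral.integral_const_mul,
      ← intervalIntegral.integral_const_mul, ← intervalIntegral.integral_const_mul,
      ← intervalIntegral.integral_add ((hcF.const_mul _).intervalIntegrable _ _)
        (((hexpf l').const_mul _).intervalIntegrable _ _),
      ← intervalIntegral.integral_add
        (hcS.intervalIntegrable _ _) ((hf.const_mul _).intervalIntegrable _ _)]
    refine intervalIntegral.integral_mono_on ht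
      (((hexpf l).const_mul _).intervalIntegrable _ _)
      ((hcS.add (hf.const_mul _)).intervalIntegrable _ _) fun s hs => ?_
    have := mul_le_mul_of_nonneg_right (inner s hs.1 hs.2) (hf0 s hs.1)
    calc _ = Real.exp (-(l * s)) * L * f s := by ring
      _ ≤ _ := this
      _ = _ := by ring
  have h4 : B / M * (∫ s in (0:ℝ)..t, Real.exp (-(l' * s)) * f s) ≤ A * B / M := by
    calc _ ≤ B / M * A := by
          have := hA t ht
          gcongr
      _ = _ := by ring
  have h5 := mul_le_mul_of_nonneg_left (hf1 t ht) (Real.exp_pos (-(l * t))).le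
  have h6 := mul_le_mul_of_nonneg_left (hfL t ht) hL
  have h7 := mul_le_mul_of_nonneg_right hL1 (Real.exp_pos (-(l * t))).le
  nlinarith

theorem exP_nonneg (n : ℕ) (i j : Fin (2*n+1)) : 0 ≤ exP n i j := by
  simp only [exP, Matrix.of_apply]
  split_ifs <;> norm_num

/-- The distance of a state to `z`. -/
def exLevel (n : ℕ) (i : Fin (2*n+1)) : ℕ := if i.val ≤ n then i.val else i.val - n

theorem sum_ite_val_eq_mul {N : ℕ} (k : ℕ) (hk : k < N) (c : ℝ) (f : Fin N → ℝ) :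
    ∑ j : Fin N, (if j.val = k then c else 0) * f j = c * f ⟨k, hk⟩ := by
  rw [Finset.sum_eq_single ⟨k, hk⟩ _ (by simp)]
  · simp
  · intro j _ hj
    rw [if_neg fun h => hj (Fin.ext h), zero_mul]

/-- The action of the chain, away from `z`, on functions of the distance to `z`. -/
theorem sum_exP_mul_level {n : ℕ} (hn : 1 ≤ n) {i : Fin (2*n+1)} (hi : i ≠ exZ n) (W : ℕ → ℝ) :
    1 ≤ exLevel n i ∧ ∑ j, exP n i j * W (exLevel n j) =
      if exLevel n i = n then W (n - 1)
      else 2/3 * W (exLevel n i - 1) + 1/3 * W (exLevel n i + 1) := by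
  obtain ⟨i, hi'⟩ := i
  have hi0 : i ≠ 0 := fun h => hi (Fin.ext h)
  have hd : exDown n i < 2 * n + 1 := by unfold exDown; split_ifs <;> omega
  have hlev : exLevel n ⟨i, hi'⟩ = if i ≤ n then i else i - n := rfl
  refine ⟨by rw [hlev]; split_ifs <;> omega, ?_⟩
  have hdl : exLevel n ⟨exDown n i, hd⟩ = exLevel n ⟨i, hi'⟩ - 1 := by
    simp only [exLevel, exDown]
    split_ifs <;> omega
  by_cases hb : i = n ∨ i = 2 * n
  · have hl : exLevel n ⟨i, hi'⟩ = n := by rw [hlev]; split_ifs <;> omega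
    simp only [exP, Matrix.of_apply, hi0, if_false, hb, if_true]
    rw [sum_ite_val_eq_mul _ hd, if_pos hl, hdl, hl, one_mul]
  · have hl : exLevel n ⟨i, hi'⟩ ≠ n := by rw [hlev]; split_ifs <;> omega
    have hu : i + 1 < 2 * n + 1 := by omega
    have hul : exLevel n ⟨i + 1, hu⟩ = exLevel n ⟨i, hi'⟩ + 1 := by
      simp only [exLevel]
      split_ifs <;> omega
    have hne : exDown n i ≠ i + 1 := by unfold exDown; split_ifs <;> omega
    simp only [exP, Matrix.of_apply, hi0, if_false, hb]
    rw [if_neg hl, ← hdl, ← hul, ← sum_ite_val_eq_mul _ hd (2/3) (fun j => W (exLevel n j)),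
      ← sum_ite_val_eq_mul _ hu (1/3) (fun j => W (exLevel n j)), ← Finset.sum_add_distrib]
    refine Finset.sum_congr rfl fun j _ => ?_
    rw [← add_mul]
    congr 1
    split_ifs with h1 h2
    · exact absurd (h1.symm.trans h2) hne
    all_goals norm_num

theorem exP_row {n : ℕ} (hn : 1 ≤ n) (i : Fin (2*n+1)) (hi : i ≠ exZ n) :
    ∑ j, exP n i j = 1 := by
  have := (sum_exP_mul_level hn hi (fun _ => 1)).2
  simp only [mul_one] at this
  rw [this]
  split_ifs <;> norm_num

/-- The Laplace exponent at which `m ↦ r ^ m` is harmonic for the biased walk. -/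
def exRate (r : ℝ) : ℝ := (1 - r) * (2 - r) / (3 * r)

theorem exRate_nonneg {r : ℝ} (h0 : 0 < r) (h1 : r < 1) : 0 ≤ exRate r :=
  div_nonneg (mul_nonneg (by linarith) (by linarith)) (by linarith)

theorem exRate_subharmonic {n : ℕ} (hn : 1 ≤ n) {r : ℝ} (h0 : 0 < r) (h1 : r < 1)
    (i : Fin (2*n+1)) (hi : i ≠ exZ n) :
    (1 + exRate r) * r ^ exLevel n i ≤ ∑ j, exP n i j * r ^ exLevel n j := by
  obtain ⟨hl, hs⟩ := sum_exP_mul_level hn hi (fun m => r ^ m)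
  rw [hs]
  obtain ⟨m, hm⟩ := Nat.exists_eq_add_of_le' hl
  have hr : 1 + exRate r = (r ^ 2 + 2) / (3 * r) := by
    unfold exRate; field_simp; ring
  rw [hm, hr, pow_succ r m]
  have hp : 0 < r ^ m := pow_pos h0 m
  split_ifs with h
  · rw [← h, Nat.add_sub_cancel]
    have : (r ^ 2 + 2) / (3 * r) * (r ^ m * r) = r ^ m * ((r ^ 2 + 2) / 3) := by field_simp
    rw [this]
    exact mul_le_of_le_one_right hp.le (by nlinarith)
  · apply le_of_eq
    rw [Nat.add_sub_cancel]
    field_simp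
    ring

theorem exists_exRate_superharmonic {n : ℕ} (hn : 1 ≤ n) {r : ℝ} (h0 : 0 < r) (h1 : r < 1) :
    ∃ W : ℕ → ℝ, (∀ m, 0 ≤ W m) ∧ 1 ≤ W 0 ∧ W n ≤ 2 * r ^ n ∧
      ∀ i : Fin (2*n+1), i ≠ exZ n →
        ∑ j, exP n i j * W (exLevel n j) ≤ (1 + exRate r) * W (exLevel n i) := by
  set κ : ℝ := 2 * (1 - r ^ 2) / (4 - r ^ 2) with hκ
  have hr2 : r ^ 2 < 1 := by nlinarith
  have h4 : 0 < 4 - r ^ 2 := by linarith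
  have hκ0 : 0 ≤ κ := div_nonneg (by linarith) h4.le
  have hκ1 : κ ≤ 1 := by rw [hκ, div_le_one h4]; nlinarith
  have hr : 1 + exRate r = (r ^ 2 + 2) / (3 * r) := by
    unfold exRate; field_simp; ring
  have hβ : 0 ≤ κ * (r ^ 2 / 2) ^ n := by positivity
  have hprod : ∀ m, κ * (r ^ 2 / 2) ^ m * (2 / r) ^ m = κ * r ^ m := by
    intro m
    rw [mul_assoc, ← mul_pow]
    congr 2
    field_simp
  refine ⟨fun m => r ^ m + κ * (r ^ 2 / 2) ^ n * (2 / r) ^ m, ?_, ?_, ?_, ?_⟩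
  · intro m; positivity
  · simpa using hβ
  · simp only [hprod]
    nlinarith [pow_pos h0 n]
  · intro i hi
    obtain ⟨hl, hs⟩ := sum_exP_mul_level hn hi
      (fun m => r ^ m + κ * (r ^ 2 / 2) ^ n * (2 / r) ^ m)
    rw [hs]
    apply le_of_eq
    obtain ⟨m, hm⟩ := Nat.exists_eq_add_of_le' hl
    split_ifs with h
    · rw [h, hr]
      obtain ⟨k, rfl⟩ := Nat.exists_eq_add_of_le' hn
      have hk : κ * (r ^ 2 / 2) ^ (k + 1) * (2 / r) ^ k = κ * r ^ k * (r ^ 2 / 2) := by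
        rw [← hprod k]; ring
      simp only [Nat.add_sub_cancel, hprod, hk]
      rw [hκ, pow_succ r k]
      field_simp
      ring
    · rw [hm, hr, Nat.add_sub_cancel]
      simp only [pow_succ _ (m + 1), pow_succ _ m]
      generalize κ * (r ^ 2 / 2) ^ n = β
      generalize (2 / r) ^ m = u
      generalize r ^ m = v
      field_simp
      ring

theorem exLevel_exZ (n : ℕ) : exLevel n (exZ n) = 0 := by simp [exLevel, exZ]

theorem exLevel_exA (n : ℕ) : exLevel n (exA n) = n := by simp [exLevel, exA]

theorem exLevel_exB (n : ℕ) : exLevel n (exB n) = n := by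
  rcases Nat.eq_zero_or_pos n with rfl | h
  · rfl
  · exact (if_neg (by simp only [exB]; omega)).trans (by simp only [exB]; omega)

theorem exA_ne_exZ {n : ℕ} (hn : 1 ≤ n) : exA n ≠ exZ n :=
  fun h => by have := congrArg Fin.val h; simp only [exA, exZ] at this; omega

theorem exB_ne_exZ {n : ℕ} (hn : 1 ≤ n) : exB n ≠ exZ n :=
  fun h => by have := congrArg Fin.val h; simp only [exB, exZ] at this; omega

theorem lazyM_nonneg {W : Type} [DecidableEq W] {P : Matrix W W ℝ} (hP : ∀ i j, 0 ≤ P i j)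
    (i j : W) :
    0 ≤ lazyM P i j := by
  simp only [lazyM, Matrix.smul_apply, Matrix.add_apply, Matrix.one_apply, smul_eq_mul]
  have := hP i j
  split_ifs <;> positivity

theorem sum_lazyM_mul (P : Matrix V V ℝ) (w : V → ℝ) (i : V) :
    ∑ j, lazyM P i j * w j = (w i + ∑ j, P i j * w j) / 2 := by
  simp only [lazyM, Matrix.smul_apply, Matrix.add_apply, Matrix.one_apply, smul_eq_mul, mul_assoc,
    ← Finset.mul_sum, add_mul, Finset.sum_add_distrib, ite_mul, one_mul, zero_mul]
  simp
  ring

theorem exCDFc_eq {n : ℕ} (hn : 1 ≤ n) (t : ℝ) :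
    exCDFc n t = ∫ s in (0:ℝ)..t, hitDens (exP n) (exZ n) ⟨exA n, exA_ne_exZ hn⟩ s *
      (1 - (heatRestr (exP n) (exZ n) (t - s)).mulVec (fun _ => 1) ⟨exB n, exB_ne_exZ hn⟩) := by
  simp [exCDFc, exDens, exSurv, exA_ne_exZ hn, exB_ne_exZ hn, hitDens, Matrix.mulVec, dotProduct]

theorem laplace_exP_le {n : ℕ} (hn : 1 ≤ n) {r : ℝ} (h0 : 0 < r) (h1 : r < 1)
    {x : Fin (2*n+1)} (hx : x ≠ exZ n) (hl : exLevel n x = n) (u : ℝ) (hu : 0 ≤ u) :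
    ∫ s in (0:ℝ)..u, Real.exp (-(exRate r * s)) * hitDens (exP n) (exZ n) ⟨x, hx⟩ s ≤
      2 * r ^ n := by
  obtain ⟨W, hW0, hWz, hWn, hW⟩ := exists_exRate_superharmonic hn h0 h1
  have := laplace_hitDens_le (exP_nonneg n) (w := fun i => W (exLevel n i)) (fun i => hW0 _)
    (by simpa only [exLevel_exZ] using hWz) hW ⟨x, hx⟩ hu
  refine this.trans ?_
  simpa only [hl] using hWn

theorem le_laplace_exP {n : ℕ} (hn : 1 ≤ n) {r : ℝ} (h0 : 0 < r) (h1 : r < 1)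
    {x : Fin (2*n+1)} (hx : x ≠ exZ n) (hl : exLevel n x = n) (u : ℝ) (hu : 0 ≤ u) :
    r ^ n ≤ (∫ s in (0:ℝ)..u, Real.exp (-(exRate r * s)) * hitDens (exP n) (exZ n) ⟨x, hx⟩ s) +
      Real.exp (-(exRate r * u)) := by
  have := le_laplace_hitDens_add (exP_nonneg n) (exP_row hn) (w := fun i => r ^ exLevel n i)
    (fun i => pow_le_one₀ h0.le h1.le) (exRate_subharmonic hn h0 h1) ⟨x, hx⟩ hu
  simpa only [hl] using this

theorem exCDFc_le {n : ℕ} (hn : 1 ≤ n) {r : ℝ} (h0 : 0 < r) (h1 : r < 1) {t : ℝ} (ht : 0 ≤ t) :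
    exCDFc n t ≤ Real.exp (exRate r * t) * (2 * r ^ n * (2 * r ^ n)) := by
  rw [exCDFc_eq hn]
  exact integral_conv_le (F := fun u => 1 - (heatRestr (exP n) (exZ n) u).mulVec
      (fun _ => 1) ⟨exB n, exB_ne_exZ hn⟩) (continuous_hitDens _ _ _) (continuous_hitDens _ _ _)
    (continuous_const.sub (continuous_heatRestr_mulVec _ _ _ _))
    (fun s hs => hitDens_nonneg (exP_nonneg n) _ _ hs)
    (fun s hs => hitDens_nonneg (exP_nonneg n) _ _ hs)
    (fun u => heatRestr_mulVec_one (exP_row hn) _ u) (exRate_nonneg h0 h1)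
    (laplace_exP_le hn h0 h1 _ (exLevel_exA n)) (laplace_exP_le hn h0 h1 _ (exLevel_exB n)) ht

theorem le_exCDFc {n : ℕ} (hn : 1 ≤ n) {r r' M : ℝ} (h0 : 0 < r) (h1 : r < 1) (h0' : 0 < r')
    (h1' : r' < 1) (hr : exRate r' ≤ 2 * exRate r) (hM : 0 < M) {t : ℝ} (ht : 0 ≤ t) :
    (r ^ n) ^ 2 - 2 * Real.exp (-(exRate r * t)) - 2 * r' ^ n * (2 * r' ^ n) / M ≤
      M * exCDFc n t := by
  rw [exCDFc_eq hn]
  refine le_integral_conv (F := fun u => 1 - (heatRestr (exP n) (exZ n) u).mulVec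
      (fun _ => 1) ⟨exB n, exB_ne_exZ hn⟩) (continuous_hitDens _ _ _) (continuous_hitDens _ _ _)
    (continuous_const.sub (continuous_heatRestr_mulVec _ _ _ _))
    (fun s hs => hitDens_nonneg (exP_nonneg n) _ _ hs)
    (fun s hs => hitDens_nonneg (exP_nonneg n) _ _ hs)
    (fun u => heatRestr_mulVec_one (exP_row hn) _ u) hM hr (by positivity)
    (pow_le_one₀ h0.le h1.le) (fun u hu => ?_)
    (le_laplace_exP hn h0 h1 _ (exLevel_exA n)) (le_laplace_exP hn h0 h1 _ (exLevel_exB n))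
    (laplace_exP_le hn h0' h1' _ (exLevel_exA n)) (laplace_exP_le hn h0' h1' _ (exLevel_exB n)) ht
  have := laplace_hitDens_le (exP_nonneg n) (y := exZ n) (l := 0) (w := fun _ => 1)
    (fun _ => zero_le_one) le_rfl (fun x hx => by simp [exP_row hn x hx])
    ⟨exA n, exA_ne_exZ hn⟩ hu
  simpa using this

/-- The Laplace exponent of the lazy chain corresponding to `exRate r`. -/
def exLazyRate (r : ℝ) : ℝ := Real.log (1 + exRate r / 2)

theorem exp_neg_exLazyRate {r : ℝ} (h0 : 0 < r) (h1 : r < 1) :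
    Real.exp (-exLazyRate r) = (1 + exRate r / 2)⁻¹ := by
  rw [Real.exp_neg, exLazyRate, Real.exp_log]
  linarith [exRate_nonneg h0 h1]

theorem exLazyRate_nonneg {r : ℝ} (h0 : 0 < r) (h1 : r < 1) : 0 ≤ exLazyRate r :=
  Real.log_nonneg (by linarith [exRate_nonneg h0 h1])

theorem hitGen_exP_le {n : ℕ} (hn : 1 ≤ n) {r : ℝ} (h0 : 0 < r) (h1 : r < 1)
    {x : Fin (2*n+1)} (hl : exLevel n x = n) (u : ℕ) :
    hitGen (lazyM (exP n)) (exZ n) (Real.exp (-exLazyRate r)) u x ≤ 2 * r ^ n := by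
  obtain ⟨W, hW0, hWz, hWn, hW⟩ := exists_exRate_superharmonic hn h0 h1
  have := hitGen_le (lazyM_nonneg (exP_nonneg n)) (y := exZ n) (Real.exp_pos (-exLazyRate r)).le
    (w := fun i => W (exLevel n i)) (fun i => hW0 _)
    (by simpa only [exLevel_exZ] using hWz) (fun i hi => ?_) u x
  · refine this.trans ?_
    simpa only [hl] using hWn
  · rw [sum_lazyM_mul, exp_neg_exLazyRate h0 h1,
      inv_mul_le_iff₀ (by linarith [exRate_nonneg h0 h1])]
    linarith [hW i hi]

theorem le_hitGen_exP {n : ℕ} (hn : 1 ≤ n) {r : ℝ} (h0 : 0 < r) (h1 : r < 1)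
    {x : Fin (2*n+1)} (hl : exLevel n x = n) (u : ℕ) :
    r ^ n ≤ hitGen (lazyM (exP n)) (exZ n) (Real.exp (-exLazyRate r)) u x +
      Real.exp (-exLazyRate r) ^ u := by
  have := le_hitGen_add (lazyM_nonneg (exP_nonneg n)) (y := exZ n) (fun i hi => ?_)
    (Real.exp_pos (-exLazyRate r)).le
    (w := fun i => r ^ exLevel n i) (fun i => pow_le_one₀ h0.le h1.le) (fun i hi => ?_) u x
  · simpa only [hl] using this
  · have := sum_lazyM_mul (exP n) (fun _ => 1) i
    simp only [mul_one, exP_row hn i hi] at this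
    linarith
  · rw [sum_lazyM_mul, exp_neg_exLazyRate h0 h1,
      le_inv_mul_iff₀ (by linarith [exRate_nonneg h0 h1])]
    linarith [exRate_subharmonic hn h0 h1 i hi]

theorem exp_neg_pow (l : ℝ) (t : ℕ) : Real.exp (-l) ^ t = Real.exp (-(l * t)) := by
  rw [← Real.exp_nat_mul]; ring_nf

theorem exCDFd_le {n : ℕ} (hn : 1 ≤ n) {r : ℝ} (h0 : 0 < r) (h1 : r < 1) (t : ℕ) :
    exCDFd n t ≤ Real.exp (exLazyRate r * t) * (2 * r ^ n * (2 * r ^ n)) := by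
  have := hitSumCDF_le (lazyM_nonneg (exP_nonneg n)) (Real.exp_pos (-exLazyRate r))
    (Real.exp_le_one_iff.2 (neg_nonpos.2 (exLazyRate_nonneg h0 h1))) t
    (hitGen_exP_le hn h0 h1 (exLevel_exA n) t) (hitGen_exP_le hn h0 h1 (exLevel_exB n) t)
  rw [exp_neg_pow, Real.exp_neg, inv_mul_le_iff₀ (Real.exp_pos _)] at this
  exact this

theorem le_exCDFd {n : ℕ} (hn : 1 ≤ n) {r r' M : ℝ} (h0 : 0 < r) (h1 : r < 1) (h0' : 0 < r')
    (h1' : r' < 1) (hr : exLazyRate r' ≤ 2 * exLazyRate r) (hM : 0 < M) (t : ℕ) :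
    (r ^ n) ^ 2 - 2 * Real.exp (-(exLazyRate r * t)) - 2 * r' ^ n * (2 * r' ^ n) / M ≤
      M * exCDFd n t := by
  rw [← exp_neg_pow]
  refine le_hitSumCDF (lazyM_nonneg (exP_nonneg n)) (Real.exp_pos _)
    (Real.exp_pos (-exLazyRate r')) hM ?_ (by positivity)
    (pow_le_one₀ h0.le h1.le) t (le_hitGen_exP hn h0 h1 (exLevel_exA n) t) ?_
    (le_hitGen_exP hn h0 h1 (exLevel_exB n))
    (hitGen_exP_le hn h0' h1' (exLevel_exA n) t) (hitGen_exP_le hn h0' h1' (exLevel_exB n))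
    (by positivity)
  · rw [exp_neg_pow]
    apply Real.exp_le_exp.2
    push_cast
    linarith
  · refine hitGen_le (lazyM_nonneg (exP_nonneg n)) zero_le_one (w := fun _ => 1)
      (fun _ => zero_le_one) le_rfl (fun i hi => ?_) t _
    rw [sum_lazyM_mul]
    simp [exP_row hn i hi]

theorem exRate_bounds {ε : ℝ} (h0 : 0 < ε) (h1 : ε ≤ 1/2) :
    2 * ε + 3 * ε ^ 2 ≤ 6 * exRate (1 - ε) ∧ 6 * exRate (1 - ε) ≤ 2 * ε + 8 * ε ^ 2 := by
  have h : 6 * exRate (1 - ε) = 2 * ε * (1 + ε) / (1 - ε) := by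
    have : (1 - ε) ≠ 0 := by linarith
    unfold exRate; field_simp; ring
  have hp : 0 < 1 - ε := by linarith
  rw [h, le_div_iff₀ hp, div_le_iff₀ hp]
  constructor <;> nlinarith [pow_pos h0 2, pow_pos h0 3]

theorem exLazyRate_bounds {ε : ℝ} (h0 : 0 < ε) (h1 : ε ≤ 1/2) :
    2 * ε + 3 * ε ^ 2 ≤ 12 * exLazyRate (1 - ε) ∧
      12 * exLazyRate (1 - ε) ≤ 2 * ε + 8 * ε ^ 2 := by
  have hp : 0 < 1 - ε := by linarith
  have hx : 0 < 1 + exRate (1 - ε) / 2 := by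
    linarith [exRate_nonneg hp (by linarith : 1 - ε < 1)]
  constructor
  · have h : 1 - (1 + exRate (1 - ε) / 2)⁻¹ = ε * (1 + ε) / ((2 - ε) * (3 - ε)) := by
      have h2 : 2 - ε ≠ 0 := by linarith
      have h3 : 3 - ε ≠ 0 := by linarith
      have : 1 + exRate (1 - ε) / 2 = (2 - ε) * (3 - ε) / (6 * (1 - ε)) := by
        unfold exRate; field_simp; ring
      rw [this]; field_simp; ring
    have hl := Real.one_sub_inv_le_log_of_pos hx
    rw [h, div_le_iff₀ (mul_pos (by linarith) (by linarith))] at hl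
    change _ ≤ exLazyRate (1 - ε) * _ at hl
    by_contra! hc
    have hq : 0 < (2 - ε) * (3 - ε) := mul_pos (by linarith) (by linarith)
    nlinarith [mul_lt_mul_of_pos_right hc hq, pow_pos h0 2, pow_pos h0 3]
  · have hl := Real.log_le_sub_one_of_pos hx
    change exLazyRate (1 - ε) ≤ _ at hl
    linarith [(exRate_bounds h0 h1).2]

theorem two_rpow_neg (x : ℝ) : (2 : ℝ) ^ (-x) = Real.exp (-(Real.log 2 * x)) := by
  rw [Real.rpow_def_of_pos two_pos, mul_neg]

theorem eventually_le_mul_natCast {a : ℝ} (ha : 0 < a) (b : ℝ) :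
    ∀ᶠ n : ℕ in atTop, b ≤ a * n :=
  (tendsto_natCast_atTop_atTop.const_mul_atTop ha).eventually_ge_atTop b

theorem eventually_lt_two_rpow {K : ℝ} (hK0 : 0 ≤ K) (hK : K ≤ 12) {η : ℝ → ℝ}
    (hη : ∀ ε, 0 < ε → ε ≤ 1/2 → 2 * ε + 3 * ε ^ 2 ≤ K * η (1 - ε) ∧
      K * η (1 - ε) ≤ 2 * ε + 8 * ε ^ 2) {δ : ℝ} (hδ0 : 0 < δ) (hδ : δ < 1/2) :
    ∀ᶠ n : ℕ in atTop, ∀ t G : ℝ, t ≤ K * n - 60 * √δ * n →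
      (∀ r, 0 < r → r < 1 → G ≤ Real.exp (η r * t) * (2 * r ^ n * (2 * r ^ n))) →
      G < 2 ^ (-(δ * n)) := by
  filter_upwards [eventually_le_mul_natCast (mul_pos two_pos hδ0) 4] with n hn t G ht hG
  set ε : ℝ := √δ / 2 with hε
  have hs : √δ ^ 2 = δ := Real.sq_sqrt hδ0.le
  have hs0 : 0 < √δ := Real.sqrt_pos.2 hδ0
  have hs1 : √δ ≤ 1 := Real.sqrt_le_one.2 (by linarith)
  have hε0 : 0 < ε := by positivity
  have hε1 : ε ≤ 1/2 := by linarith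
  obtain ⟨hl, hu⟩ := hη ε hε0 hε1
  set e := η (1 - ε)
  have he : ε / 6 ≤ e := by
    by_contra! hc
    nlinarith [pow_pos hε0 2, mul_le_mul_of_nonneg_left hc.le hK0]
  have hn0 : (0 : ℝ) ≤ n := n.cast_nonneg
  have hpow : (1 - ε) ^ n ≤ Real.exp (-(ε * n)) := by
    rw [← exp_neg_pow]
    exact pow_le_pow_left₀ (by linarith) (Real.one_sub_le_exp_neg ε) n
  have hp0 : 0 ≤ (1 - ε) ^ n := pow_nonneg (by linarith) n
  have het : e * t - 2 * (ε * n) ≤ -(3 * (δ * n)) := by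
    have h1 : e * t ≤ e * (K * n - 60 * √δ * n) :=
      mul_le_mul_of_nonneg_left ht (by linarith)
    have h2 : K * e * n ≤ (2 * ε + 8 * ε ^ 2) * n := mul_le_mul_of_nonneg_right hu hn0
    have h3 : ε / 6 * (√δ * n) ≤ e * (√δ * n) := mul_le_mul_of_nonneg_right he (by positivity)
    have h4 : δ = 4 * ε ^ 2 := by rw [← hs, hε]; ring
    have h5 : √δ = 2 * ε := by rw [hε]; ring
    rw [h5] at h1 h3
    rw [h4]
    nlinarith
  calc G ≤ Real.exp (e * t) * (2 * (1 - ε) ^ n * (2 * (1 - ε) ^ n)) :=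
        hG _ (by linarith) (by linarith)
    _ ≤ Real.exp (e * t) * (2 * Real.exp (-(ε * n)) * (2 * Real.exp (-(ε * n)))) := by gcongr
    _ = 4 * Real.exp (e * t - 2 * (ε * n)) := by
        rw [show e * t - 2 * (ε * n) = e * t + -(ε * n) + -(ε * n) by ring, Real.exp_add,
          Real.exp_add]
        ring
    _ ≤ 4 * Real.exp (-(3 * (δ * n))) := by gcongr
    _ < Real.exp (2 * δ * n) * Real.exp (-(3 * (δ * n))) := by
        gcongr
        linarith [Real.add_one_le_exp (2 * δ * n)]
    _ = Real.exp (-(δ * n)) := by rw [← Real.exp_add]; ring_nf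
    _ ≤ 2 ^ (-(δ * n)) := by
        rw [two_rpow_neg]
        have hx : 0 ≤ δ * n := by positivity
        exact Real.exp_le_exp.2 (neg_le_neg (mul_le_of_le_one_left hx
          (by linarith [Real.log_two_lt_d9])))

set_option maxHeartbeats 800000 in
theorem eventually_two_rpow_le {K : ℝ} (hK : 6 ≤ K) {η : ℝ → ℝ}
    (hη : ∀ ε, 0 < ε → ε ≤ 1/2 → 2 * ε + 3 * ε ^ 2 ≤ K * η (1 - ε) ∧
      K * η (1 - ε) ≤ 2 * ε + 8 * ε ^ 2) {δ : ℝ} (hδ0 : 0 < δ) (hδ : δ < 1/2) :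
    ∀ᶠ n : ℕ in atTop, ∀ t G : ℝ, K * n - √δ / 100 * n ≤ t →
      (∀ r r' M, 0 < r → r < 1 → 0 < r' → r' < 1 → η r' ≤ 2 * η r → 0 < M →
        (r ^ n) ^ 2 - 2 * Real.exp (-(η r * t)) - 2 * r' ^ n * (2 * r' ^ n) / M ≤ M * G) →
      2 ^ (-(δ * n)) ≤ G := by
  set ε : ℝ := √δ / 100 with hε
  have hs : √δ ^ 2 = δ := Real.sq_sqrt hδ0.le
  have hs0 : 0 < √δ := Real.sqrt_pos.2 hδ0
  have hs1 : √δ ≤ 4/5 := Real.sqrt_le_iff.2 ⟨by norm_num, by linarith⟩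
  have hε0 : 0 < ε := by positivity
  have hε1 : ε ≤ 1/125 := by linarith
  have hεδ : ε ^ 2 = δ / 10000 := by rw [hε, div_pow, hs]; norm_num
  filter_upwards [eventually_le_mul_natCast (half_pos (pow_pos hε0 2)) 3,
    eventually_le_mul_natCast (half_pos hδ0) (Real.log 64)] with n hn hn' t G ht hG
  have hn0 : (0 : ℝ) ≤ n := n.cast_nonneg
  obtain ⟨hl, hu⟩ := hη ε hε0 (by linarith)
  have hε2 : ε ^ 2 ≤ ε / 125 := by nlinarith
  set ε' : ℝ := 2 * ε - 16 * ε ^ 2 with hε'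
  have hε'0 : 0 < ε' := by linarith
  obtain ⟨-, hu'⟩ := hη ε' hε'0 (by linarith)
  have hrate : η (1 - ε') ≤ 2 * η (1 - ε) := by
    have : ε' ^ 2 ≤ (2 * ε) ^ 2 := by
      gcongr
      linarith [sq_nonneg ε]
    have : K * η (1 - ε') ≤ K * (2 * η (1 - ε)) := by nlinarith
    exact le_of_mul_le_mul_left this (by linarith)
  set r : ℝ := 1 - ε with hr
  set r' : ℝ := 1 - ε' with hr'
  have hr0 : 0 < r := by linarith
  have hr0' : 0 < r' := by linarith
  set A : ℝ := (r ^ n) ^ 2 with hA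
  set B : ℝ := (r' ^ n) ^ 2 with hB
  have hA0 : 0 < A := by positivity
  have hB0 : 0 < B := by positivity
  have hmain := hG r r' (16 * B / A) hr0 (by linarith) hr0' (by linarith) hrate (by positivity)
  have hlog : ∀ x : ℝ, 0 ≤ x → x ≤ 1/4 → Real.exp (-(x + x ^ 2)) ≤ 1 - x := by
    intro x hx hx1
    rw [Real.exp_neg]
    apply inv_le_of_inv_le₀ (by linarith)
    refine le_trans ?_ (Real.quadratic_le_exp_of_nonneg (by positivity))
    rw [inv_le_iff_one_le_mul₀ (by linarith)]
    nlinarith [pow_nonneg hx 2, pow_nonneg hx 3, pow_nonneg hx 4, pow_nonneg hx 5]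
  have hAexp : Real.exp (-((2 * ε + 2 * ε ^ 2) * n)) ≤ A := by
    rw [hA, ← pow_mul, mul_comm n 2, pow_mul]
    have : Real.exp (-((2 * ε + 2 * ε ^ 2) * n)) = (Real.exp (-(ε + ε ^ 2)) ^ 2) ^ n := by
      rw [← pow_mul, ← Real.exp_nat_mul]
      push_cast
      ring_nf
    rw [this]
    gcongr
    exact hlog ε hε0.le (by linarith)
  have hexp : 2 * Real.exp (-(η r * t)) ≤ A / 2 := by
    have he0 : 0 ≤ η r := by
      refine le_of_mul_le_mul_left ?_ (by linarith : 0 < K)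
      rw [mul_zero]
      exact le_trans (by positivity) hl
    have he : η r * ε ≤ ε ^ 2 / 2 := by
      have h6 : 6 * η r ≤ K * η r := mul_le_mul_of_nonneg_right hK he0
      have h7 : η r ≤ ε / 2 := by linarith
      linarith [mul_le_mul_of_nonneg_right h7 hε0.le]
    have h1 : (2 * ε + 5/2 * ε ^ 2) * n ≤ η r * t := by
      have := mul_le_mul_of_nonneg_left ht he0
      linarith [mul_le_mul_of_nonneg_right hl hn0, mul_le_mul_of_nonneg_right he hn0]
    have h2 : 4 * Real.exp (-(η r * t)) ≤ Real.exp (-((2 * ε + 2 * ε ^ 2) * n)) := by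
      calc 4 * Real.exp (-(η r * t)) ≤
            Real.exp (ε ^ 2 / 2 * n) * Real.exp (-((2 * ε + 5/2 * ε ^ 2) * n)) := by
            gcongr
            linarith [Real.add_one_le_exp (ε ^ 2 / 2 * n)]
        _ = _ := by rw [← Real.exp_add]; ring_nf
    linarith
  have hBM : 2 * r' ^ n * (2 * r' ^ n) / (16 * B / A) = A / 4 := by
    rw [hB]; field_simp; norm_num
  rw [hBM] at hmain
  have hGA : A ^ 2 ≤ 64 * B * G := by
    have : A / 4 ≤ 16 * B / A * G := by linarith
    rw [div_mul_eq_mul_div, le_div_iff₀ hA0] at this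
    linarith
  have hratio : Real.exp (-(δ / 10 * n)) * B ≤ A ^ 2 := by
    have h1 : A ^ 2 = ((r ^ 2) ^ 2) ^ n := by rw [hA]; ring_nf
    have h2 : Real.exp (-(δ / 10 * n)) * B = ((Real.exp (-(δ / 20)) * r') ^ 2) ^ n := by
      rw [hB, ← exp_neg_pow, show -(δ / 10) = -(δ / 20) + -(δ / 20) by ring, Real.exp_add]; ring_nf
    rw [h1, h2]
    gcongr
    have h3 : Real.exp (-(δ / 20)) ≤ 1 - δ / 40 := by
      rw [Real.exp_neg]
      apply inv_le_of_inv_le₀ (by linarith)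
      refine le_trans ?_ (Real.add_one_le_exp (δ / 20))
      rw [inv_le_iff_one_le_mul₀ (by linarith)]
      nlinarith
    calc Real.exp (-(δ / 20)) * r' ≤ (1 - δ / 40) * r' := by gcongr
      _ ≤ r ^ 2 := by rw [show δ = 10000 * ε ^ 2 by linarith]; nlinarith
  have hfin : Real.exp (-(δ / 10 * n)) ≤ 64 * G := by
    refine le_of_mul_le_mul_right ?_ hB0
    linarith
  have h64 : 64 * (2 : ℝ) ^ (-(δ * n)) ≤ Real.exp (-(δ / 10 * n)) := by
    rw [two_rpow_neg]
    nth_rewrite 1 [← Real.exp_log (by norm_num : (0 : ℝ) < 64)]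
    rw [← Real.exp_add]
    gcongr
    have : 0 ≤ δ * n := by positivity
    nlinarith [Real.log_two_gt_d9]
  linarith

/-- **Example 3.3.** Uniformly in `δ ∈ (0,1/2)`, `(12n - t_δ)/(√δ n) = Θ(1)` and
`(6n - τ_δ)/(√δ n) = Θ(1)`. -/
theorem tdelta_taudelta_location :
    ∃ c C : ℝ, 0 < c ∧ 0 < C ∧
      ∀ δ : ℝ, 0 < δ → δ < 1/2 →
        ∃ n₀ : ℕ, ∀ n : ℕ, n₀ ≤ n →
          (c * Real.sqrt δ * n ≤ 12 * n - (tdelta n δ : ℝ) ∧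
            12 * n - (tdelta n δ : ℝ) ≤ C * Real.sqrt δ * n) ∧
          (c * Real.sqrt δ * n ≤ 6 * n - taudelta n δ ∧
            6 * n - taudelta n δ ≤ C * Real.sqrt δ * n) := by
  refine ⟨1/200, 60, by norm_num, by norm_num, fun δ hδ0 hδ => ?_⟩
  have hs0 : 0 < √δ := Real.sqrt_pos.2 hδ0
  have hs1 : √δ ≤ 1 := Real.sqrt_le_one.2 (by linarith)
  have hlazy : ∀ ε, 0 < ε → ε ≤ 1/2 → 2 * ε + 3 * ε ^ 2 ≤ 12 * exLazyRate (1 - ε) ∧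
      12 * exLazyRate (1 - ε) ≤ 2 * ε + 8 * ε ^ 2 := fun _ => exLazyRate_bounds
  have hcont : ∀ ε, 0 < ε → ε ≤ 1/2 → 2 * ε + 3 * ε ^ 2 ≤ 6 * exRate (1 - ε) ∧
      6 * exRate (1 - ε) ≤ 2 * ε + 8 * ε ^ 2 := fun _ => exRate_bounds
  have h := (eventually_lt_two_rpow (by norm_num) le_rfl hlazy hδ0 hδ).and
    ((eventually_lt_two_rpow (by norm_num) (by norm_num) hcont hδ0 hδ).and
    ((eventually_two_rpow_le (by norm_num) hlazy hδ0 hδ).and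
    ((eventually_two_rpow_le le_rfl hcont hδ0 hδ).and
    ((eventually_le_mul_natCast (by positivity : 0 < √δ / 200) 1).and
    (eventually_ge_atTop 1)))))
  obtain ⟨n₀, hn₀⟩ := eventually_atTop.1 h
  refine ⟨n₀, fun n hn => ?_⟩
  obtain ⟨hdu, hcu, hdl, hcl, hbig, hn1⟩ := hn₀ n hn
  have hsn : √δ * n ≤ n := mul_le_of_le_one_left n.cast_nonneg hs1
  have hsn0 : 0 ≤ √δ * n := by positivity
  refine ⟨?_, ?_⟩
  · set t : ℕ := ⌊12 * n - 1/200 * √δ * n⌋₊ with ht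
    have hle : (t : ℝ) ≤ 12 * n - 1/200 * √δ * n := Nat.floor_le (by linarith)
    have hge : 12 * n - 1/200 * √δ * n < (t : ℝ) + 1 := Nat.lt_floor_add_one _
    have hmem : t ∈ {t : ℕ | (2 : ℝ) ^ (-(δ * n)) ≤ exCDFd n t} :=
      hdl t _ (by linarith) fun r r' M h0 h1 h0' h1' hr hM =>
        le_exCDFd hn1 h0 h1 h0' h1' hr hM t
    have hT : (tdelta n δ : ℝ) ≤ t := Nat.cast_le.2 (Nat.sInf_le hmem)
    have hTmem : (2 : ℝ) ^ (-(δ * n)) ≤ exCDFd n (tdelta n δ) := Nat.sInf_mem ⟨t, hmem⟩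
    refine ⟨by linarith, ?_⟩
    by_contra! hc
    exact absurd hTmem (not_le.2 (hdu (tdelta n δ) _ (by linarith) fun r h0 h1 =>
      exCDFd_le hn1 h0 h1 _))
  · set t : ℝ := 6 * n - 1/200 * √δ * n with ht
    have ht0 : 0 ≤ t := by linarith
    have hmem : t ∈ {t : ℝ | 0 ≤ t ∧ (2 : ℝ) ^ (-(δ * n)) ≤ exCDFc n t} :=
      ⟨ht0, hcl t _ (by linarith) fun r r' M h0 h1 h0' h1' hr hM =>
        le_exCDFc hn1 h0 h1 h0' h1' hr hM ht0⟩
    have hT : taudelta n δ ≤ t := csInf_le ⟨0, fun _ hx => hx.1⟩ hmem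
    have hT' : 6 * n - 60 * √δ * n ≤ taudelta n δ := by
      refine le_csInf ⟨t, hmem⟩ fun u hu => ?_
      by_contra! hc
      exact absurd hu.2 (not_le.2 (hcu u _ hc.le fun r h0 h1 => exCDFc_le hn1 h0 h1 hu.1))
    exact ⟨by linarith, by linarith⟩

end
end
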